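/- Let K = S(U(p) × U(q)) with p ≥ q ≥ 5, and let H = S(U(p−q) × U(1)^q) ⊂ K be the identity component of a principal isotropy group of the action of K on ℂ^p ⊗_ℂ ℂ^{q*} (with U(p−q) acting on the last p−q coordinates of ℂ^p and U(1)^q embedded diagonally in U(p) × U(q)). If G is a proper closed connected subgroup of K such that G × H acts on K with cohomogeneity at most one by left and right translations, then G = SU(p) × SU(q). -/

import Mathlib

/-! Statement 14: if `K = S(U p × U q)` (`p ≥ q ≥ 5`), `H = S(U(p-q) × U(1)^q)` the identity
component of a principal isotropy group of the isotropy representation of the complex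
Grassmannian, and `G` is a proper closed connected subgroup of `K` such that `G × H` acts
on `K` with cohomogeneity at most one, then `G = SU p × SU q`. -/
open Module

noncomputable section

/-- The tangent space at `x` of a set `S` of matrices: the span of all entrywise
velocities at `0` of curves in `S` passing through `x`. -/
def matTangentAt {m n R : Type*} [NormedAddCommGroup R] [NormedSpace ℝ R]
    (S : Set (Matrix m n R)) (x : Matrix m n R) : Submodule ℝ (Matrix m n R) :=
  Submodule.span ℝ {w | ∃ c : ℝ → Matrix m n R, (∀ t, c t ∈ S) ∧ c 0 = x ∧
    ∀ i j, HasDerivAt (fun t => c t i j) (w i j) 0}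

variable {n : Type*} {R : Type*} [Fintype n] [DecidableEq n] [Semiring R] [StarRing R]

/-- A set of square matrices is a subgroup (of a unitary group) if it contains `1` and is
closed under multiplication and conjugate transposition (= inversion, for unitary
matrices). -/
def IsMatSubgroup (G : Set (Matrix n n R)) : Prop :=
  (1 : Matrix n n R) ∈ G ∧ (∀ a ∈ G, ∀ b ∈ G, a * b ∈ G) ∧ ∀ a ∈ G, star a ∈ G

/-- The orbit of `k` under the action of `G × H` by left and right translations,
`(g, h) · k = g * k * h⁻¹` (for unitary matrices `h⁻¹ = star h`). -/
def lrOrbit (G H : Set (Matrix n n R)) (k : Matrix n n R) : Set (Matrix n n R) :=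
  {x | ∃ g ∈ G, ∃ h ∈ H, x = g * k * star h}

/-- The dimension of a matrix group: the dimension of its tangent space at `1`. -/
def grpDim [NormedAddCommGroup R] [NormedSpace ℝ R] (K : Set (Matrix n n R)) : ℕ :=
  finrank ℝ (matTangentAt K 1)

/-- The cohomogeneity of the action of `G × H` on `K` by left and right translations:
`dim K` minus the maximal orbit dimension. -/
def lrCohomogeneity [NormedAddCommGroup R] [NormedSpace ℝ R]
    (G H K : Set (Matrix n n R)) : ℕ :=
  grpDim K - ⨆ k : K, finrank ℝ (matTangentAt (lrOrbit G H k) (k : Matrix n n R))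

end

noncomputable section

/-- The group `S(U p × U q)`: block-diagonal unitary matrices indexed by `Fin p ⊕ Fin q`
of total determinant one. -/
def SUPairSet (p q : ℕ) : Set (Matrix (Fin p ⊕ Fin q) (Fin p ⊕ Fin q) ℂ) :=
  {A | star A * A = 1 ∧ A * star A = 1 ∧
    (∀ (i : Fin p) (j : Fin q), A (Sum.inl i) (Sum.inr j) = 0 ∧ A (Sum.inr j) (Sum.inl i) = 0) ∧
    A.det = 1}

/-- The subgroup `SU p × SU q ⊆ S(U p × U q)`. -/
def SUProdSet (p q : ℕ) : Set (Matrix (Fin p ⊕ Fin q) (Fin p ⊕ Fin q) ℂ) :=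
  {A | A ∈ SUPairSet p q ∧ (Matrix.toBlocks₁₁ A).det = 1 ∧ (Matrix.toBlocks₂₂ A).det = 1}

/-- The subgroup `S(U(p-q) × U(1)^q) ⊆ S(U p × U q)`: `U(p-q)` acts on the last `p-q`
coordinates of `ℂ^p`, and `U(1)^q` is embedded diagonally in `U p × U q`. -/
def SUPrincipalIsotropy (p q : ℕ) (hqp : q ≤ p) :
    Set (Matrix (Fin p ⊕ Fin q) (Fin p ⊕ Fin q) ℂ) :=
  {A | A ∈ SUPairSet p q ∧
    -- the first `q` rows of the `U p`-block are diagonal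
    (∀ i : Fin p, (i : ℕ) < q → ∀ j, j ≠ Sum.inl i → A (Sum.inl i) j = 0) ∧
    -- the last `p - q` rows of the `U p`-block are supported on the last `p - q` columns
    (∀ i : Fin p, q ≤ (i : ℕ) → ∀ j : Fin p, (j : ℕ) < q → A (Sum.inl i) (Sum.inl j) = 0) ∧
    -- the `U q`-block is diagonal
    (∀ i j : Fin q, i ≠ j → A (Sum.inr i) (Sum.inr j) = 0) ∧
    -- the two diagonal parts match (diagonal embedding of `U(1)^q`)
    ∀ i : Fin q, A (Sum.inr i) (Sum.inr i) =
      A (Sum.inl ⟨(i : ℕ), lt_of_lt_of_le i.isLt hqp⟩)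
        (Sum.inl ⟨(i : ℕ), lt_of_lt_of_le i.isLt hqp⟩)}

end

noncomputable section

section FrobeniusForm

open Matrix

lemma skew_apply {n : Type*} {X : Matrix n n ℂ} (hX : Xᴴ = -X) (i j : n) :
    X j i = - star (X i j) := by
  have := congrFun (congrFun hX j) i
  rw [conjTranspose_apply, neg_apply] at this
  rw [this, neg_neg]

variable {n : Type*} [Fintype n]

/-- The real Frobenius inner product `Re tr (Xᴴ Y)` on complex matrices. -/
def frobForm : LinearMap.BilinForm ℝ (Matrix n n ℂ) :=
  LinearMap.mk₂ ℝ (fun X Y => (trace (Xᴴ * Y)).re)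
    (by intro X Y Z; simp [add_mul])
    (by intro c X Y; simp [Matrix.conjTranspose_smul])
    (by intro X Y Z; simp [mul_add])
    (by intro c X Y; simp)

lemma frobForm_apply (X Y : Matrix n n ℂ) : frobForm X Y = (trace (Xᴴ * Y)).re := rfl

lemma frobForm_eq_sum (X Y : Matrix n n ℂ) :
    frobForm X Y = ∑ i, ∑ j, ((X i j).re * (Y i j).re + (X i j).im * (Y i j).im) := by
  rw [frobForm_apply, trace, Complex.re_sum, Finset.sum_comm]
  refine Finset.sum_congr rfl fun i _ => ?_
  rw [diag_apply, mul_apply, Complex.re_sum]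
  refine Finset.sum_congr rfl fun j _ => ?_
  simp [conjTranspose_apply]

lemma frobForm_comm (X Y : Matrix n n ℂ) : frobForm X Y = frobForm Y X := by
  simp only [frobForm_eq_sum, mul_comm]

lemma frobForm_eq_zero_of_disjoint {X Y : Matrix n n ℂ} (h : ∀ i j, X i j = 0 ∨ Y i j = 0) :
    frobForm X Y = 0 := by
  rw [frobForm_eq_sum]
  refine Finset.sum_eq_zero fun i _ => Finset.sum_eq_zero fun j _ => ?_
  rcases h i j with h | h <;> simp [h]

lemma eq_zero_of_frobForm_self {X : Matrix n n ℂ} (h : frobForm X X = 0) : X = 0 := by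
  rw [frobForm_eq_sum] at h
  have h0 : ∀ i j, 0 ≤ (X i j).re * (X i j).re + (X i j).im * (X i j).im := fun i j =>
    add_nonneg (mul_self_nonneg _) (mul_self_nonneg _)
  rw [Finset.sum_eq_zero_iff_of_nonneg fun i _ => Finset.sum_nonneg fun j _ => h0 i j] at h
  ext i j
  have := h i (Finset.mem_univ _)
  rw [Finset.sum_eq_zero_iff_of_nonneg fun j _ => h0 i j] at this
  have := this j (Finset.mem_univ _)
  rw [← Complex.normSq_apply] at this
  simpa using this

/-- Orthogonal projection for the Frobenius form. -/
lemma exists_frobForm_proj (U : Submodule ℝ (Matrix n n ℂ)) (X : Matrix n n ℂ) :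
    ∃ A ∈ U, ∀ V ∈ U, frobForm V (X - A) = 0 := by
  have hrefl : (frobForm (n := n)).IsRefl := fun X Y h => by rw [frobForm_comm, h]
  have hc : IsCompl U (frobForm.orthogonal U) := by
    rw [LinearMap.BilinForm.isCompl_orthogonal_iff_disjoint hrefl, Submodule.disjoint_def]
    intro x hx hx'
    exact eq_zero_of_frobForm_self (hx' x hx)
  obtain ⟨A, hA, B, hB, rfl⟩ := Submodule.mem_sup.1 (hc.sup_eq_top ▸ Submodule.mem_top (x := X))
  refine ⟨A, hA, fun V hV => ?_⟩
  rw [add_sub_cancel_left]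
  exact hB V hV

lemma frobForm_bracket {Y : Matrix n n ℂ} (hY : Yᴴ = -Y) (X Z : Matrix n n ℂ) :
    frobForm (Y * X - X * Y) Z = - frobForm X (Y * Z - Z * Y) := by
  rw [frobForm_apply, frobForm_apply, conjTranspose_sub, conjTranspose_mul, conjTranspose_mul, hY,
    ← Complex.neg_re, ← trace_neg]
  congr 1
  simp only [sub_mul, mul_sub, mul_neg, neg_mul, trace_sub, trace_neg, Matrix.mul_assoc]
  rw [trace_mul_comm Y]
  simp only [Matrix.mul_assoc]
  ring

lemma bracket_skew {X Y : Matrix n n ℂ} (hX : Xᴴ = -X) (hY : Yᴴ = -Y) :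
    (X * Y - Y * X)ᴴ = -(X * Y - Y * X) := by
  rw [conjTranspose_sub, conjTranspose_mul, conjTranspose_mul, hX, hY]
  simp

/-- The real subspace of skew-Hermitian matrices. -/
def skewSub (n : Type*) [Fintype n] : Submodule ℝ (Matrix n n ℂ) where
  carrier := {X | Xᴴ = -X}
  add_mem' := by
    intro a b ha hb
    simp only [Set.mem_ofPred_eq] at *
    rw [conjTranspose_add, ha, hb, neg_add]
  zero_mem' := by simp
  smul_mem' := by
    intro c X hX
    simp only [Set.mem_ofPred_eq] at *
    rw [conjTranspose_smul, hX]; simp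

/-- The real-linear map `Y ↦ [Y, X]`. -/
def adR (X : Matrix n n ℂ) : Matrix n n ℂ →ₗ[ℝ] Matrix n n ℂ where
  toFun Y := Y * X - X * Y
  map_add' := by intro a b; simp only [add_mul, mul_add]; abel
  map_smul' := by intro c a; simp [smul_sub]

lemma adR_apply (X Y : Matrix n n ℂ) : adR X Y = Y * X - X * Y := rfl

/-- A real Lie subalgebra of the skew-Hermitian matrices. -/
structure IsSkewLie (L : Submodule ℝ (Matrix n n ℂ)) : Prop where
  skew : ∀ X ∈ L, Xᴴ = -X
  bracket : ∀ X ∈ L, ∀ Y ∈ L, X * Y - Y * X ∈ L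

/-- The orthogonal complement of `L` in the skew-Hermitian matrices. -/
def skewOrth (L : Submodule ℝ (Matrix n n ℂ)) : Submodule ℝ (Matrix n n ℂ) :=
  skewSub n ⊓ frobForm.orthogonal L

lemma mem_skewOrth {L : Submodule ℝ (Matrix n n ℂ)} {X : Matrix n n ℂ} :
    X ∈ skewOrth L ↔ Xᴴ = -X ∧ ∀ Z ∈ L, frobForm Z X = 0 := Iff.rfl

lemma bracket_mem_skewOrth {L : Submodule ℝ (Matrix n n ℂ)} (hL : IsSkewLie L)
    {X Y : Matrix n n ℂ} (hY : Y ∈ L) (hX : X ∈ skewOrth L) : Y * X - X * Y ∈ skewOrth L := by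
  refine ⟨bracket_skew (hL.skew Y hY) hX.1, fun Z hZ => ?_⟩
  change frobForm Z _ = 0
  rw [frobForm_comm, frobForm_bracket (hL.skew Y hY), frobForm_comm,
    (mem_skewOrth.1 hX).2 _ (hL.bracket Y hY Z hZ), neg_zero]

lemma skewSub_le_sup {L : Submodule ℝ (Matrix n n ℂ)} (hL : IsSkewLie L) :
    skewSub n ≤ L ⊔ skewOrth L := by
  intro X hX
  obtain ⟨A, hA, h⟩ := exists_frobForm_proj L X
  refine Submodule.mem_sup.2 ⟨A, hA, X - A, ⟨?_, h⟩, by abel⟩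
  exact Submodule.sub_mem _ hX (hL.skew A hA)

lemma skewOrth_bracket_le {L : Submodule ℝ (Matrix n n ℂ)} (hL : IsSkewLie L)
    {X : Matrix n n ℂ} (hX : X ∈ skewOrth L) (hX0 : X ≠ 0) :
    finrank ℝ (L.map (adR X)) + 1 ≤ finrank ℝ (skewOrth L) ∧
    finrank ℝ ((skewSub n).map (adR X)) + 1 ≤
      finrank ℝ (L.map (adR X)) + finrank ℝ (skewOrth L) := by
  constructor
  · apply Submodule.finrank_lt_finrank_of_lt
    refine lt_of_le_of_ne ?_ ?_
    · rintro _ ⟨Y, hY, rfl⟩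
      exact bracket_mem_skewOrth hL hY hX
    · intro h
      rw [← h] at hX
      obtain ⟨Y, hY, hYX⟩ := hX
      rw [adR_apply] at hYX
      apply hX0
      apply eq_zero_of_frobForm_self
      have h1 := frobForm_bracket (hL.skew Y hY) X X
      rw [hYX, frobForm_comm] at h1
      linarith
  · have h1 : (skewSub n).map (adR X) ≤ L.map (adR X) ⊔ (skewOrth L).map (adR X) := by
      rw [← Submodule.map_sup]
      exact Submodule.map_mono (skewSub_le_sup hL)
    have h2 := (Submodule.finrank_mono h1).trans (Submodule.finrank_add_le_finrank_add_finrank _ _)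
    have h3 := LinearMap.finrank_range_add_finrank_ker ((adR X).domRestrict (skewOrth L))
    rw [LinearMap.range_domRestrict] at h3
    have h4 : 1 ≤ finrank ℝ (LinearMap.ker ((adR X).domRestrict (skewOrth L))) := by
      rw [Submodule.one_le_finrank_iff]
      intro hbot
      have : (⟨X, hX⟩ : skewOrth L) ∈ LinearMap.ker ((adR X).domRestrict (skewOrth L)) := by
        simp [adR_apply]
      rw [hbot, Submodule.mem_bot] at this
      exact hX0 (congrArg Subtype.val this)
    omega

end FrobeniusForm

section FullUnitary

open Matrix

variable {n : Type*} [Fintype n] [DecidableEq n]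

lemma exists_unitary_diag {X : Matrix n n ℂ} (hX : Xᴴ = -X) :
    ∃ (U : Matrix n n ℂ) (d : n → ℝ), U * Uᴴ = 1 ∧ Uᴴ * U = 1 ∧
      X = U * diagonal (fun i => Complex.I * d i) * Uᴴ := by
  have hA : ((-Complex.I) • X).IsHermitian := by
    rw [IsHermitian, conjTranspose_smul, hX]; simp
  refine ⟨hA.eigenvectorUnitary, hA.eigenvalues, ?_, ?_, ?_⟩
  · exact Unitary.coe_mul_star_self _
  · exact Unitary.coe_star_mul_self _
  · have h := hA.spectral_theorem
    rw [Unitary.conjStarAlgAut_apply] at h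
    have h2 : X = Complex.I • ((-Complex.I) • X) := by simp [smul_smul]
    have h3 : diagonal (fun i => Complex.I * (hA.eigenvalues i : ℂ)) =
        Complex.I • diagonal (RCLike.ofReal ∘ hA.eigenvalues : n → ℂ) := by
      rw [← diagonal_smul]; rfl
    rw [h3, mul_smul_comm, smul_mul_assoc]
    conv_lhs => rw [h2, h]
    rfl

lemma card_le_finrank_map_adR {U : Matrix n n ℂ} {d : n → ℝ} (hU : Uᴴ * U = 1) :
    Fintype.card {x : n × n // d x.1 ≠ d x.2} ≤
      finrank ℝ ((skewSub n).map (adR (U * diagonal (fun i => Complex.I * d i) * Uᴴ))) := by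
  set X := U * diagonal (fun i => Complex.I * d i) * Uᴴ with hX
  let Ψ : Matrix n n ℂ →ₗ[ℝ] ({x : n × n // d x.1 ≠ d x.2} → ℝ) :=
    { toFun := fun Z x => ((Uᴴ * Z * U) x.1.1 x.1.2).re + ((Uᴴ * Z * U) x.1.1 x.1.2).im
      map_add' := by
        intro A B; ext x; simp [mul_add, add_mul]; ring
      map_smul' := by
        intro c A; ext x; simp; ring }
  have hsurj : ((skewSub n).map (adR X)).map Ψ = ⊤ := by
    rw [eq_top_iff]
    intro f _
    let F : n → n → ℝ := fun i j => if h : d i ≠ d j then f ⟨(i, j), h⟩ else 0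
    let Z : Matrix n n ℂ := of fun i j => (((F i j - F j i) / 2 : ℝ) : ℂ) +
      Complex.I * (((F i j + F j i) / 2 : ℝ) : ℂ)
    let Y : Matrix n n ℂ := of fun i j => -Z i j * Complex.I / ((d j - d i : ℝ) : ℂ)
    have hY : Yᴴ = -Y := by
      ext i j
      have e : ((d j - d i : ℝ) : ℂ) = -((d i - d j : ℝ) : ℂ) := by push_cast; ring
      rw [Matrix.neg_apply]
      simp only [conjTranspose_apply, Y, Z, of_apply, e, map_neg, Complex.star_def, map_div₀,
        map_mul, map_add, Complex.conj_I, Complex.conj_ofReal, div_neg]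
      push_cast
      ring
    refine ⟨adR X (U * Y * Uᴴ), ⟨_, ?_, rfl⟩, ?_⟩
    · change (U * Y * Uᴴ)ᴴ = _
      simp [conjTranspose_mul, hY, Matrix.mul_assoc]
    · have h1 : Uᴴ * adR X (U * Y * Uᴴ) * U = Y * diagonal (fun i => Complex.I * (d i : ℂ)) -
          diagonal (fun i => Complex.I * (d i : ℂ)) * Y := by
        rw [adR_apply, hX]
        generalize diagonal (fun i => Complex.I * (d i : ℂ)) = D
        have e1 : Uᴴ * (U * Y * Uᴴ * (U * D * Uᴴ)) * U =
            (Uᴴ * U) * Y * (Uᴴ * U) * D * (Uᴴ * U) := by simp only [Matrix.mul_assoc]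
        have e2 : Uᴴ * (U * D * Uᴴ * (U * Y * Uᴴ)) * U =
            (Uᴴ * U) * D * (Uᴴ * U) * Y * (Uᴴ * U) := by simp only [Matrix.mul_assoc]
        rw [mul_sub, sub_mul, e1, e2, hU]
        simp
      ext ⟨⟨i, j⟩, hij⟩
      change ((Uᴴ * adR X (U * Y * Uᴴ) * U) i j).re + ((Uᴴ * adR X (U * Y * Uᴴ) * U) i j).im = _
      have hd : ((d j - d i : ℝ) : ℂ) ≠ 0 := by
        rw [Complex.ofReal_ne_zero]; exact sub_ne_zero.2 (Ne.symm hij)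
      have h2 : (Y * diagonal (fun i => Complex.I * (d i : ℂ)) -
          diagonal (fun i => Complex.I * (d i : ℂ)) * Y) i j = Z i j := by
        rw [Matrix.sub_apply, mul_diagonal, diagonal_mul]
        have : Y i j * (Complex.I * d j) - Complex.I * d i * Y i j
          = Complex.I * (Y i j * ((d j - d i : ℝ) : ℂ)) := by push_cast; ring
        rw [this]
        change Complex.I * (-Z i j * Complex.I / ((d j - d i : ℝ) : ℂ) * _) = _
        rw [div_mul_cancel₀ _ hd]
        linear_combination -Z i j * Complex.I_mul_I
      rw [h1, h2]
      have hF : F i j = f ⟨(i, j), hij⟩ := dif_pos hij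
      simp only [Z, of_apply, Complex.add_re, Complex.add_im, Complex.ofReal_re, Complex.ofReal_im,
        Complex.mul_re, Complex.mul_im, Complex.I_re, Complex.I_im, hF]
      ring
  have h := Submodule.finrank_map_le Ψ ((skewSub n).map (adR X))
  rw [hsurj, finrank_top, Module.finrank_fintype_fun_eq_card] at h
  exact h

/-- A matrix is a scalar plus a Hermitian matrix of rank one, up to complex scalars. -/
def IsScalarAddRankOne (X : Matrix n n ℂ) : Prop :=
  ∃ (b β : ℂ) (v : n → ℂ), ∀ i j, X i j = (if i = j then b else 0) + β * (v i * star (v j))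

lemma IsScalarAddRankOne.conj {X U : Matrix n n ℂ} (h : IsScalarAddRankOne X)
    (hU : Uᴴ * U = 1) : IsScalarAddRankOne (Uᴴ * X * U) := by
  obtain ⟨b, β, v, h⟩ := h
  have hX : X = b • (1 : Matrix n n ℂ) + β • vecMulVec v (star v) := by
    ext i j
    rw [h]
    simp [one_apply, vecMulVec_apply]
  refine ⟨b, β, Uᴴ *ᵥ v, fun i j => ?_⟩
  have h2 : Uᴴ * X * U = b • (1 : Matrix n n ℂ) +
      β • vecMulVec (Uᴴ *ᵥ v) (star (Uᴴ *ᵥ v)) := by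
    rw [hX, mul_add, add_mul, mul_smul_comm, smul_mul_assoc, Matrix.mul_one, hU, mul_smul_comm,
      smul_mul_assoc, mul_vecMulVec, vecMulVec_mul, star_mulVec, conjTranspose_conjTranspose]
  rw [h2]
  simp [one_apply, vecMulVec_apply]

/-- A matrix whose nonzero entries all lie in the off-diagonal part of one row and one column is
zero as soon as it is a scalar plus a matrix of rank one. -/
lemma IsScalarAddRankOne.eq_zero {X : Matrix n n ℂ} (h : IsScalarAddRankOne X)
    (hn : 3 ≤ Fintype.card n) (k : n) (hd : ∀ i, X i i = 0)
    (h0 : ∀ i j, i ≠ k → j ≠ k → X i j = 0) : X = 0 := by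
  obtain ⟨b, β, v, h⟩ := h
  obtain ⟨i, j, hij, hi, hj⟩ : ∃ i j, i ≠ j ∧ i ≠ k ∧ j ≠ k := by
    have : 1 < (Finset.univ.erase k).card := by
      rw [Finset.card_erase_of_mem (Finset.mem_univ _), Finset.card_univ]; omega
    obtain ⟨i, hi, j, hj, hij⟩ := Finset.one_lt_card.1 this
    exact ⟨i, j, hij, Finset.ne_of_mem_erase hi, Finset.ne_of_mem_erase hj⟩
  have hb : b = 0 := by
    have e := h0 i j hi hj
    rw [h, if_neg hij, zero_add] at e
    have hii := hd i
    have hjj := hd j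
    rw [h, if_pos rfl] at hii hjj
    rcases mul_eq_zero.1 e with e | e
    · rw [e] at hii; simpa using hii
    · rcases mul_eq_zero.1 e with e | e
      · rw [e] at hii; simpa using hii
      · rw [e] at hjj; simpa using hjj
  have hv : ∀ i, β * v i = 0 := by
    intro i
    have hii := hd i
    rw [h, if_pos rfl, hb, zero_add] at hii
    rcases mul_eq_zero.1 hii with e | e
    · rw [e, zero_mul]
    · rcases mul_eq_zero.1 e with e | e
      · rw [e, mul_zero]
      · rw [star_eq_zero.1 e, mul_zero]
  ext i j
  rw [h, hb, ite_self, zero_add, ← mul_assoc, hv, zero_mul]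
  rfl

lemma card_offDiag_eq_sum {n : Type*} [Fintype n] (d : n → ℝ) :
    Fintype.card {x : n × n // d x.1 ≠ d x.2} =
      ∑ i, (Finset.univ.filter fun j => d i ≠ d j).card := by
  rw [Fintype.card_subtype, ← Finset.univ_product_univ, Finset.card_filter, Finset.sum_product]
  simp only [Finset.card_filter]

/-- A nonscalar skew-Hermitian `X` has `ad X` of rank at least `n`, and of rank at least `2 n`
unless `X` is a scalar plus a matrix of rank one. -/
lemma finrank_adR_ge {X : Matrix n n ℂ} (hX : Xᴴ = -X) (hns : ∀ a : ℝ, X ≠ (Complex.I * a) • 1) :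
    Fintype.card n ≤ finrank ℝ ((skewSub n).map (adR X)) ∧
    (2 * Fintype.card n ≤ finrank ℝ ((skewSub n).map (adR X)) ∨
      ∃ (U : Matrix n n ℂ) (d : n → ℝ) (k : n) (a : ℝ), U * Uᴴ = 1 ∧ Uᴴ * U = 1 ∧
        X = U * diagonal (fun i => Complex.I * d i) * Uᴴ ∧ ∀ i, i ≠ k → d i = a) := by
  obtain ⟨U, d, hU, hU', hXd⟩ := exists_unitary_diag hX
  have hcard := card_le_finrank_map_adR (d := d) hU'
  rw [← hXd, card_offDiag_eq_sum] at hcard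
  have h1 : ∀ i, 1 ≤ (Finset.univ.filter fun j => d i ≠ d j).card := by
    intro i
    by_contra hlt
    have hem : (Finset.univ.filter fun j => d i ≠ d j) = ∅ := by
      rw [← Finset.card_eq_zero]; omega
    apply hns (d i)
    have hd : d = fun _ => d i := by
      funext j
      by_contra hne
      have : j ∈ (Finset.univ.filter fun j => d i ≠ d j) := by simpa using Ne.symm hne
      rw [hem] at this
      simp at this
    rw [hXd, hd]
    have : (diagonal fun _ : n => Complex.I * ((d i : ℝ) : ℂ)) =
      (Complex.I * (d i : ℂ)) • (1 : Matrix n n ℂ) := by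
      rw [← diagonal_one, ← diagonal_smul]; ext; simp [diagonal]
    rw [this, mul_smul_comm, smul_mul_assoc, Matrix.mul_one, hU]
  refine ⟨le_trans ?_ hcard, ?_⟩
  · calc Fintype.card n = ∑ _i : n, 1 := by simp
      _ ≤ _ := Finset.sum_le_sum fun i _ => h1 i
  · by_cases hk : ∃ k, ∀ i, i ≠ k → ∀ j, j ≠ k → d i = d j
    · right
      obtain ⟨k, hk⟩ := hk
      by_cases hex : ∃ i, i ≠ k
      · obtain ⟨i, hi⟩ := hex
        exact ⟨U, d, k, d i, hU, hU', hXd, fun j hj => hk j hj i hi⟩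
      · push Not at hex
        exact ⟨U, d, k, 0, hU, hU', hXd, fun j hj => absurd (hex j) hj⟩
    · left
      refine le_trans ?_ hcard
      calc 2 * Fintype.card n = ∑ _i : n, 2 := by simp [mul_comm]
        _ ≤ _ := Finset.sum_le_sum fun i _ => ?_
      by_contra hlt
      apply hk
      have h1' := h1 i
      obtain ⟨k, hk⟩ := Finset.card_eq_one.1 (show (Finset.univ.filter fun j => d i ≠ d j).card = 1
        by omega)
      refine ⟨k, ?_⟩
      have : ∀ j, j ≠ k → d i = d j := by
        intro j hj
        by_contra hne
        have : j ∈ (Finset.univ.filter fun j => d i ≠ d j) := by simpa using hne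
        rw [hk] at this
        exact hj (by simpa using this)
      intro x hx y hy
      rw [← this x hx, ← this y hy]

/-- A real vector space any two of whose elements are dependent has dimension at most one. -/
lemma finrank_le_one_of_dependent {V : Type*} [AddCommGroup V] [Module ℝ V]
    (h : ∀ v w : V, ∃ s t : ℝ, (s ≠ 0 ∨ t ≠ 0) ∧ s • v + t • w = 0) : finrank ℝ V ≤ 1 := by
  by_cases h0 : ∃ v : V, v ≠ 0
  · obtain ⟨v, hv⟩ := h0
    refine finrank_le_one v fun w => ?_
    obtain ⟨s, t, hst, e⟩ := h v w
    have ht : t ≠ 0 := by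
      rintro rfl
      rw [zero_smul, add_zero, smul_eq_zero] at e
      rcases e with e | e
      · simp [e] at hst
      · exact hv e
    refine ⟨-(t⁻¹ * s), ?_⟩
    have e' : t • w = -(s • v) := by
      rw [eq_neg_iff_add_eq_zero, add_comm]; exact e
    rw [neg_smul, mul_smul, ← smul_neg, ← e', smul_smul, inv_mul_cancel₀ ht, one_smul]
  · push Not at h0
    exact finrank_le_one 0 fun w => ⟨0, by rw [h0 w, smul_zero]⟩

/-- If `L + t` has codimension at most one in `𝔲(n)`, `n ≥ 3`, where `t` is the diagonal torus and
`L` is a Lie subalgebra containing the scalars, then `L = 𝔲(n)`. -/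
lemma eq_skewSub_of_offDiag {L : Submodule ℝ (Matrix n n ℂ)} (hL : IsSkewLie L)
    (hn : 3 ≤ Fintype.card n) (h1 : Complex.I • (1 : Matrix n n ℂ) ∈ L)
    (H : ∀ X Y : Matrix n n ℂ, Xᴴ = -X → Yᴴ = -Y → (∀ i, X i i = 0) → (∀ i, Y i i = 0) →
      ∃ s t : ℝ, (s ≠ 0 ∨ t ≠ 0) ∧ ∃ Z ∈ L, ∀ i j, i ≠ j → Z i j = (s • X + t • Y) i j) :
    L = skewSub n := by
  have htr : ∀ X ∈ skewOrth L, ∑ i, (X i i).im = 0 := by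
    intro X hX
    have := (mem_skewOrth.1 hX).2 _ h1
    rw [frobForm_apply] at this
    simpa [trace, conjTranspose_smul] using this
  have hc : finrank ℝ (skewOrth L) ≤ Fintype.card n := by
    have hne : Nonempty n := Fintype.card_pos_iff.1 (by omega)
    let k : n := hne.some
    let δ : skewOrth L →ₗ[ℝ] ({i : n // i ≠ k} → ℝ) :=
      { toFun := fun X i => ((X : Matrix n n ℂ) i i).im
        map_add' := by intro A B; ext i; simp
        map_smul' := by intro c A; ext i; simp }
    have hrn := LinearMap.finrank_range_add_finrank_ker δ
    have hr : finrank ℝ (LinearMap.range δ) ≤ Fintype.card n - 1 := by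
      refine (Submodule.finrank_le _).trans ?_
      rw [Module.finrank_fintype_fun_eq_card, Fintype.card_subtype_compl]
      simp
    have hk : finrank ℝ (LinearMap.ker δ) ≤ 1 := by
      have hdiag : ∀ X : LinearMap.ker δ, ∀ i, (X : Matrix n n ℂ) i i = 0 := by
        intro X
        have him : ∀ i, i ≠ k → ((X : Matrix n n ℂ) i i).im = 0 := fun i hi =>
          congrFun (LinearMap.mem_ker.1 X.2) ⟨i, hi⟩
        have him' : ∀ i, ((X : Matrix n n ℂ) i i).im = 0 := by
          intro i
          by_cases hi : i = k
          · have := htr _ X.1.2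
            rw [Finset.sum_eq_single k (fun j _ hj => him j hj) (by simp)] at this
            rw [hi]; exact this
          · exact him i hi
        intro i
        apply Complex.ext
        · have := congrArg Complex.re (skew_apply (mem_skewOrth.1 X.1.2).1 i i)
          simp at this
          simp; linarith
        · exact him' i
      refine finrank_le_one_of_dependent (V := LinearMap.ker δ) fun X Y => ?_
      obtain ⟨s, t, hst, Z, hZ, hZe⟩ := H X Y (mem_skewOrth.1 X.1.2).1 (mem_skewOrth.1 Y.1.2).1
        (hdiag X) (hdiag Y)
      refine ⟨s, t, hst, ?_⟩
      have hW : (s • X + t • Y : LinearMap.ker δ).1.1 = s • X.1.1 + t • Y.1.1 := rfl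
      apply Subtype.ext
      apply Subtype.ext
      rw [hW]
      apply eq_zero_of_frobForm_self
      have e1 : frobForm Z (s • X.1.1 + t • Y.1.1) = 0 :=
        (mem_skewOrth.1 (hW ▸ (s • X + t • Y : LinearMap.ker δ).1.2)).2 Z hZ
      have e2 : frobForm (s • X.1.1 + t • Y.1.1 - Z) (s • X.1.1 + t • Y.1.1) = 0 := by
        apply frobForm_eq_zero_of_disjoint
        intro i j
        by_cases hij : i = j
        · right; rw [← hij, ← hW]; exact hdiag _ i
        · left; rw [Matrix.sub_apply, hZe i j hij, sub_self]
      rw [map_sub, LinearMap.sub_apply, e1, sub_zero] at e2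
      exact e2
    omega
  have hns : ∀ X ∈ skewOrth L, X ≠ 0 → ∀ a : ℝ, X ≠ (Complex.I * a) • 1 := by
    intro X hX hX0 a ha
    have := htr X hX
    rw [ha] at this
    have ha0 : a = 0 := by
      simp at this
      rcases this with h | h
      · omega
      · exact h
    apply hX0
    rw [ha, ha0]; simp
  have hrank : ∀ X ∈ skewOrth L, X ≠ 0 → ∃ (U : Matrix n n ℂ) (d : n → ℝ) (k : n) (a : ℝ),
      U * Uᴴ = 1 ∧ Uᴴ * U = 1 ∧
        X = U * diagonal (fun i => Complex.I * d i) * Uᴴ ∧ ∀ i, i ≠ k → d i = a := by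
    intro X hX hX0
    have e1 := skewOrth_bracket_le hL hX hX0
    rcases (finrank_adR_ge (mem_skewOrth.1 hX).1 (hns X hX hX0)).2 with e2 | e2
    · omega
    · exact e2
  have hm : ∀ X ∈ skewOrth L, X = 0 := by
    intro X hX
    by_contra hX0
    have hex : ∃ Y ∈ L, Y * X - X * Y ≠ 0 := by
      by_contra hne
      push Not at hne
      have hbot : L.map (adR X) = ⊥ := by
        rw [eq_bot_iff]
        rintro _ ⟨Y, hY, rfl⟩
        exact hne Y hY
      have e1 := (skewOrth_bracket_le hL hX hX0).2
      rw [hbot, finrank_bot] at e1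
      have e2 := (finrank_adR_ge (mem_skewOrth.1 hX).1 (hns X hX hX0)).1
      omega
    obtain ⟨Y, hY, hZ0⟩ := hex
    have hZ := bracket_mem_skewOrth hL hY hX
    obtain ⟨U, d, k, a, hU, hU', hXd, hk⟩ := hrank X hX hX0
    obtain ⟨V, d', k', a', hV, hV', hZd, hk'⟩ := hrank _ hZ hZ0
    have hZt : IsScalarAddRankOne (Y * X - X * Y) := by
      have : IsScalarAddRankOne (Vᴴᴴ * diagonal (fun i => Complex.I * (d' i : ℂ)) * Vᴴ) := by
        apply IsScalarAddRankOne.conj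
        · refine ⟨Complex.I * a', Complex.I * (d' k' - a'), fun i => if i = k' then 1 else 0,
            fun i j => ?_⟩
          by_cases hij : i = j
          · subst hij
            by_cases hi : i = k'
            · subst hi; simp; ring
            · simp [hi, hk' i hi]
          · by_cases hi : i = k'
            · have : j ≠ k' := fun h => hij (hi.trans h.symm)
              simp [hij, this]
            · simp [hij, hi]
        · rw [conjTranspose_conjTranspose]; exact hV
      rwa [conjTranspose_conjTranspose, ← hZd] at this
    have hZ' := hZt.conj hU'
    have key : Uᴴ * (Y * X - X * Y) * U = (Uᴴ * Y * U) * diagonal (fun i => Complex.I * (d i : ℂ)) -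
        diagonal (fun i => Complex.I * (d i : ℂ)) * (Uᴴ * Y * U) := by
      rw [hXd]
      generalize diagonal (fun i => Complex.I * (d i : ℂ)) = D
      have e1 : Uᴴ * (Y * (U * D * Uᴴ)) * U = Uᴴ * Y * U * D * (Uᴴ * U) := by
        simp only [Matrix.mul_assoc]
      have e2 : Uᴴ * (U * D * Uᴴ * Y) * U = (Uᴴ * U) * D * (Uᴴ * Y * U) := by
        simp only [Matrix.mul_assoc]
      rw [mul_sub, sub_mul, e1, e2, hU', Matrix.mul_one, Matrix.one_mul]
    have hz := hZ'.eq_zero hn k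
      (by intro i; rw [key, Matrix.sub_apply, mul_diagonal, diagonal_mul]; ring)
      (by intro i j hi hj
          rw [key, Matrix.sub_apply, mul_diagonal, diagonal_mul, hk i hi, hk j hj]; ring)
    apply hZ0
    have : Y * X - X * Y = U * (Uᴴ * (Y * X - X * Y) * U) * Uᴴ := by
      have e : U * (Uᴴ * (Y * X - X * Y) * U) * Uᴴ = (U * Uᴴ) * (Y * X - X * Y) * (U * Uᴴ) := by
        simp only [Matrix.mul_assoc]
      rw [e, hU, Matrix.one_mul, Matrix.mul_one]
    rw [this, hz]; simp
  apply le_antisymm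
  · intro X hX; exact hL.skew X hX
  · intro X hX
    obtain ⟨A, hA, B, hB, rfl⟩ := Submodule.mem_sup.1 (skewSub_le_sup hL hX)
    rw [hm B hB, add_zero]; exact hA

end FullUnitary

section BlockPairs

open Matrix

lemma bracket_add_scalar {n : Type*} [Fintype n] [DecidableEq n] (A B : Matrix n n ℂ) (c d : ℝ) :
    (A + c • (Complex.I • (1 : Matrix n n ℂ))) * (B + d • (Complex.I • (1 : Matrix n n ℂ))) -
      (B + d • (Complex.I • (1 : Matrix n n ℂ))) * (A + c • (Complex.I • (1 : Matrix n n ℂ))) =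
      A * B - B * A := by
  simp only [add_mul, mul_add, smul_mul_assoc, mul_smul_comm, Matrix.one_mul, Matrix.mul_one,
    smul_add]
  have : d • Complex.I • c • Complex.I • (1 : Matrix n n ℂ) =
      c • Complex.I • d • Complex.I • (1 : Matrix n n ℂ) := by
    ext i j; simp; ring
  rw [this]
  abel

lemma IsSkewLie.sup_scalar {n : Type*} [Fintype n] [DecidableEq n] {P : Submodule ℝ (Matrix n n ℂ)}
    (hP : IsSkewLie P) : IsSkewLie (P ⊔ Submodule.span ℝ {Complex.I • (1 : Matrix n n ℂ)}) := by
  constructor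
  · intro X hX
    obtain ⟨A, hA, B, hB, rfl⟩ := Submodule.mem_sup.1 hX
    obtain ⟨c, rfl⟩ := Submodule.mem_span_singleton.1 hB
    rw [conjTranspose_add, hP.skew A hA, conjTranspose_smul, conjTranspose_smul]
    simp [add_comm]
  · intro X hX Y hY
    obtain ⟨A, hA, B, hB, rfl⟩ := Submodule.mem_sup.1 hX
    obtain ⟨c, rfl⟩ := Submodule.mem_span_singleton.1 hB
    obtain ⟨A', hA', B', hB', rfl⟩ := Submodule.mem_sup.1 hY
    obtain ⟨c', rfl⟩ := Submodule.mem_span_singleton.1 hB'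
    refine Submodule.mem_sup_left ?_
    convert hP.bracket A hA A' hA' using 1
    exact bracket_add_scalar _ _ _ _

/-- A Lie subalgebra which has codimension at most one modulo the diagonal torus is everything up
to scalars. -/
lemma exists_mem_add_scalar {n : Type*} [Fintype n] [DecidableEq n]
    {P : Submodule ℝ (Matrix n n ℂ)} (hP : IsSkewLie P) (hn : 3 ≤ Fintype.card n)
    (H : ∀ X Y : Matrix n n ℂ, Xᴴ = -X → Yᴴ = -Y → (∀ i, X i i = 0) → (∀ i, Y i i = 0) →
      ∃ s t : ℝ, (s ≠ 0 ∨ t ≠ 0) ∧ ∃ Z ∈ P, ∀ i j, i ≠ j → Z i j = (s • X + t • Y) i j)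
    {S : Matrix n n ℂ} (hS : Sᴴ = -S) :
    ∃ X ∈ P, ∃ c : ℝ, X = S + c • (Complex.I • (1 : Matrix n n ℂ)) := by
  have h := eq_skewSub_of_offDiag hP.sup_scalar hn
    (Submodule.mem_sup_right (Submodule.mem_span_singleton_self _)) (by
      intro X Y hX hY hX0 hY0
      obtain ⟨s, t, hst, Z, hZ, h⟩ := H X Y hX hY hX0 hY0
      exact ⟨s, t, hst, Z, Submodule.mem_sup_left hZ, h⟩)
  have hS' : S ∈ P ⊔ Submodule.span ℝ {Complex.I • (1 : Matrix n n ℂ)} := by rw [h]; exact hS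
  obtain ⟨A, hA, B, hB, rfl⟩ := Submodule.mem_sup.1 hS'
  obtain ⟨c, rfl⟩ := Submodule.mem_span_singleton.1 hB
  exact ⟨A, hA, -c, by simp⟩

variable {α β : Type*}

/-- The upper left block, as a real-linear map. -/
def blockOne : Matrix (α ⊕ β) (α ⊕ β) ℂ →ₗ[ℝ] Matrix α α ℂ where
  toFun X := X.toBlocks₁₁
  map_add' _ _ := rfl
  map_smul' _ _ := rfl

/-- The lower right block, as a real-linear map. -/
def blockTwo : Matrix (α ⊕ β) (α ⊕ β) ℂ →ₗ[ℝ] Matrix β β ℂ where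
  toFun X := X.toBlocks₂₂
  map_add' _ _ := rfl
  map_smul' _ _ := rfl

/-- Block diagonal matrices. -/
def IsBlockDiag (X : Matrix (α ⊕ β) (α ⊕ β) ℂ) : Prop :=
  X = fromBlocks (blockOne X) 0 0 (blockTwo X)

lemma blockOne_fromBlocks (A : Matrix α α ℂ) (B C) (D : Matrix β β ℂ) :
    blockOne (fromBlocks A B C D) = A := rfl

lemma blockTwo_fromBlocks (A : Matrix α α ℂ) (B C) (D : Matrix β β ℂ) :
    blockTwo (fromBlocks A B C D) = D := rfl

lemma blockOne_skew {X : Matrix (α ⊕ β) (α ⊕ β) ℂ} (hX : Xᴴ = -X) :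
    (blockOne X)ᴴ = -blockOne X := by
  ext i j
  exact congrFun (congrFun hX (Sum.inl i)) (Sum.inl j)

lemma blockTwo_skew {X : Matrix (α ⊕ β) (α ⊕ β) ℂ} (hX : Xᴴ = -X) :
    (blockTwo X)ᴴ = -blockTwo X := by
  ext i j
  exact congrFun (congrFun hX (Sum.inr i)) (Sum.inr j)

variable [Fintype α] [Fintype β]

lemma IsBlockDiag.blockOne_mul {X Y : Matrix (α ⊕ β) (α ⊕ β) ℂ} (hX : IsBlockDiag X)
    (hY : IsBlockDiag Y) : blockOne (X * Y) = blockOne X * blockOne Y := by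
  conv_lhs => rw [hX, hY, fromBlocks_multiply]
  simp [blockOne_fromBlocks]

lemma IsBlockDiag.blockTwo_mul {X Y : Matrix (α ⊕ β) (α ⊕ β) ℂ} (hX : IsBlockDiag X)
    (hY : IsBlockDiag Y) : blockTwo (X * Y) = blockTwo X * blockTwo Y := by
  conv_lhs => rw [hX, hY, fromBlocks_multiply]
  simp [blockTwo_fromBlocks]

lemma IsSkewLie.map_blockOne {N : Submodule ℝ (Matrix (α ⊕ β) (α ⊕ β) ℂ)} (hN : IsSkewLie N)
    (hb : ∀ X ∈ N, IsBlockDiag X) : IsSkewLie (N.map blockOne) := by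
  constructor
  · rintro _ ⟨X, hX, rfl⟩
    exact blockOne_skew (hN.skew X hX)
  · rintro _ ⟨X, hX, rfl⟩ _ ⟨Y, hY, rfl⟩
    refine ⟨_, hN.bracket X hX Y hY, ?_⟩
    rw [map_sub, (hb X hX).blockOne_mul (hb Y hY), (hb Y hY).blockOne_mul (hb X hX)]

lemma im_sum_eq_zero_of_commute {A B : Matrix β β ℂ} (hA : Aᴴ = -A) (hB : Bᴴ = -B) (o : β)
    (h : A * B = B * A) : (∑ k, star (A k o) * B k o).im = 0 := by
  have e := congrFun (congrFun h o) o
  rw [mul_apply, mul_apply] at e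
  have e1 : ∑ k, A o k * B k o = -∑ k, star (A k o) * B k o := by
    rw [← Finset.sum_neg_distrib]
    exact Finset.sum_congr rfl fun k _ => by rw [skew_apply hA k o, neg_mul]
  have e2 : ∑ k, B o k * A k o = -star (∑ k, star (A k o) * B k o) := by
    rw [star_sum, ← Finset.sum_neg_distrib]
    refine Finset.sum_congr rfl fun k _ => ?_
    rw [skew_apply hB k o, star_mul, star_star, neg_mul]
  rw [e1, e2, neg_inj] at e
  exact Complex.conj_eq_iff_im.1 e.symm

variable [DecidableEq α] [DecidableEq β]

/-- Let `N` be a Lie algebra of block diagonal skew-Hermitian matrices whose projection to the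
off-diagonal entries of the first block and of one column of the second block has codimension at
most one. Then `N` contains the commutator algebra of the first block. -/
theorem fromBlocks_bracket_mem {N : Submodule ℝ (Matrix (α ⊕ β) (α ⊕ β) ℂ)} (hN : IsSkewLie N)
    (hb : ∀ X ∈ N, IsBlockDiag X) (hα : 3 ≤ Fintype.card α) (o : β)
    (H : ∀ X Y : Matrix α α ℂ, Xᴴ = -X → Yᴴ = -Y → (∀ i, X i i = 0) → (∀ i, Y i i = 0) →
      ∀ v w : β → ℂ, ∃ s t : ℝ, (s ≠ 0 ∨ t ≠ 0) ∧ ∃ Z ∈ N,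
        (∀ i j, i ≠ j → blockOne Z i j = (s • X + t • Y) i j) ∧
        ∀ j, j ≠ o → blockTwo Z j o = (s • v + t • w) j)
    {S T : Matrix α α ℂ} (hS : Sᴴ = -S) (hT : Tᴴ = -T) :
    fromBlocks (S * T - T * S) 0 0 0 ∈ N := by
  let col : Submodule ℝ (Matrix (α ⊕ β) (α ⊕ β) ℂ) :=
    { carrier := {X | ∀ j, j ≠ o → blockTwo X j o = 0}
      add_mem' := by
        intro X Y hX hY j hj
        rw [map_add, Matrix.add_apply, hX j hj, hY j hj, add_zero]
      zero_mem' := by intro j _; rw [map_zero]; rfl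
      smul_mem' := by
        intro c X hX j hj
        rw [map_smul, Matrix.smul_apply, hX j hj, smul_zero] }
  have hmulcol : ∀ X ∈ N ⊓ col, ∀ Y ∈ N ⊓ col, ∀ j, blockTwo (X * Y) j o =
      blockTwo X j o * blockTwo Y o o := by
    intro X hX Y hY j
    rw [(hb X hX.1).blockTwo_mul (hb Y hY.1), mul_apply]
    exact Finset.sum_eq_single o (fun k _ hk => by rw [hY.2 k hk, mul_zero]) (by simp)
  have hbrcol : ∀ X ∈ N ⊓ col, ∀ Y ∈ N ⊓ col, ∀ j, blockTwo (X * Y - Y * X) j o = 0 := by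
    intro X hX Y hY j
    rw [map_sub, Matrix.sub_apply, hmulcol X hX Y hY, hmulcol Y hY X hX]
    by_cases hj : j = o
    · subst hj; ring
    · rw [hX.2 j hj, hY.2 j hj]; ring
  have hNcol : IsSkewLie (N ⊓ col) :=
    ⟨fun X hX => hN.skew X hX.1, fun X hX Y hY =>
      ⟨hN.bracket X hX.1 Y hY.1, fun j _ => hbrcol X hX Y hY j⟩⟩
  have hlift : ∀ S : Matrix α α ℂ, Sᴴ = -S → ∃ X ∈ N ⊓ col, ∃ c : ℝ,
      blockOne X = S + c • (Complex.I • (1 : Matrix α α ℂ)) := by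
    intro S hS
    obtain ⟨_, ⟨X, hX, rfl⟩, c, hc⟩ := exists_mem_add_scalar
      (hNcol.map_blockOne fun X hX => hb X hX.1) hα (by
        intro X Y hX hY hX0 hY0
        obtain ⟨s, t, hst, Z, hZ, h1, h2⟩ := H X Y hX hY hX0 hY0 0 0
        refine ⟨s, t, hst, blockOne Z, ⟨Z, ⟨hZ, fun j hj => ?_⟩, rfl⟩, h1⟩
        rw [h2 j hj]; simp) hS
    exact ⟨X, hX, c, hc⟩
  let b : Submodule ℝ (Matrix (α ⊕ β) (α ⊕ β) ℂ) :=
    N ⊓ (Submodule.span ℝ {Complex.I • (1 : Matrix α α ℂ)}).comap blockOne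
  have hbmem : ∀ X, X ∈ N → ∀ c : ℝ, blockOne X = c • (Complex.I • (1 : Matrix α α ℂ)) → X ∈ b := by
    intro X hX c hc
    exact ⟨hX, Submodule.mem_span_singleton.2 ⟨c, hc.symm⟩⟩
  have hbbr : ∀ X ∈ N, ∀ B ∈ b, X * B - B * X ∈ b := by
    intro X hX B hB
    refine hbmem _ (hN.bracket X hX B hB.1) 0 ?_
    obtain ⟨c, hc⟩ := Submodule.mem_span_singleton.1 hB.2
    rw [map_sub, (hb X hX).blockOne_mul (hb B hB.1), (hb B hB.1).blockOne_mul (hb X hX), ← hc]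
    simp
  let a : Submodule ℝ (Matrix (α ⊕ β) (α ⊕ β) ℂ) := N ⊓ frobForm.orthogonal b
  have ha : ∀ X, X ∈ a ↔ X ∈ N ∧ ∀ B ∈ b, frobForm B X = 0 := fun X => Iff.rfl
  have hab0 : ∀ X ∈ a, X ∈ b → X = 0 := fun X hX hXb =>
    eq_zero_of_frobForm_self (((ha X).1 hX).2 X hXb)
  have hcomm : ∀ A ∈ a, ∀ B ∈ b, A * B = B * A := by
    intro A hA B hB
    rw [← sub_eq_zero]
    refine hab0 _ ((ha _).2 ⟨hN.bracket A hA.1 B hB.1, fun V hV => ?_⟩) (hbbr A hA.1 B hB)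
    rw [← neg_sub, map_neg, frobForm_comm, frobForm_bracket (hN.skew B hB.1), neg_neg,
      frobForm_comm]
    exact ((ha A).1 hA).2 _ (hbbr B hB.1 V hV)
  have habr : ∀ A ∈ a, ∀ A' ∈ a, A * A' - A' * A ∈ a := by
    intro A hA A' hA'
    refine (ha _).2 ⟨hN.bracket A hA.1 A' hA'.1, fun V hV => ?_⟩
    rw [frobForm_comm, frobForm_bracket (hN.skew A hA.1), hcomm A hA V hV, sub_self, map_zero,
      neg_zero]
  have hlifta : ∀ S : Matrix α α ℂ, Sᴴ = -S → ∃ A ∈ a, ∃ c : ℝ,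
      blockOne A = S + c • (Complex.I • (1 : Matrix α α ℂ)) := by
    intro S hS
    obtain ⟨X, hX, c, hc⟩ := hlift S hS
    obtain ⟨B, hB, h⟩ := exists_frobForm_proj b X
    obtain ⟨d, hd⟩ := Submodule.mem_span_singleton.1 hB.2
    refine ⟨X - B, (ha _).2 ⟨N.sub_mem hX.1 hB.1, h⟩, c - d, ?_⟩
    rw [map_sub, hc, ← hd, sub_smul]; abel
  have hcolb : ∀ v w : β → ℂ, ∃ s t : ℝ, (s ≠ 0 ∨ t ≠ 0) ∧ ∃ B ∈ b,
      ∀ j, j ≠ o → blockTwo B j o = (s • v + t • w) j := by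
    intro v w
    obtain ⟨s, t, hst, Z, hZ, -, h2⟩ := H 0 0 (by simp) (by simp) (by simp) (by simp) v w
    obtain ⟨Y, hY, c, hc⟩ := hlift (blockOne Z) (blockOne_skew (hN.skew Z hZ))
    refine ⟨s, t, hst, Z - Y, hbmem _ (N.sub_mem hZ hY.1) (-c) ?_, fun j hj => ?_⟩
    · rw [map_sub, hc, neg_smul]; abel
    · rw [map_sub, Matrix.sub_apply, hY.2 j hj, sub_zero, h2 j hj]
  have hdep : ∀ A ∈ a, ∀ A' ∈ a, ∃ s t : ℝ, (s ≠ 0 ∨ t ≠ 0) ∧ s • A + t • A' ∈ col := by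
    intro A hA A' hA'
    obtain ⟨s, t, hst, B, hB, h⟩ := hcolb (fun j => Complex.I * blockTwo A j o)
      (fun j => Complex.I * blockTwo A' j o)
    refine ⟨s, t, hst, ?_⟩
    set C := s • A + t • A' with hC
    have hCa : C ∈ a := a.add_mem (a.smul_mem s hA) (a.smul_mem t hA')
    have hBC : ∀ j, j ≠ o → blockTwo B j o = Complex.I * blockTwo C j o := by
      intro j hj
      rw [h j hj, hC, map_add, map_smul, map_smul]
      simp only [Pi.add_apply, Pi.smul_apply, Matrix.add_apply, Matrix.smul_apply,
        Complex.real_smul]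
      ring
    have hCs := blockTwo_skew (hN.skew C hCa.1)
    have hBs := blockTwo_skew (hN.skew B hB.1)
    have hsum := im_sum_eq_zero_of_commute hCs hBs o (by
      rw [← (hb C hCa.1).blockTwo_mul (hb B hB.1), hcomm C hCa B hB,
        (hb B hB.1).blockTwo_mul (hb C hCa.1)])
    rw [Complex.im_sum] at hsum
    have hterm : ∀ k, k ≠ o → (star (blockTwo C k o) * blockTwo B k o).im =
        Complex.normSq (blockTwo C k o) := by
      intro k hk
      rw [hBC k hk, Complex.normSq_apply]
      simp
    have hre : ∀ D : Matrix β β ℂ, Dᴴ = -D → (D o o).re = 0 := by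
      intro D hD
      have := congrArg Complex.re (skew_apply hD o o)
      simp at this
      linarith
    have h0 : (star (blockTwo C o o) * blockTwo B o o).im = 0 := by
      simp [hre _ hCs, hre _ hBs]
    rw [Finset.sum_eq_zero_iff_of_nonneg] at hsum
    · intro j hj
      have := hsum j (Finset.mem_univ _)
      rw [hterm j hj] at this
      exact Complex.normSq_eq_zero.1 this
    · intro k _
      by_cases hk : k = o
      · rw [hk, h0]
      · rw [hterm k hk]; exact Complex.normSq_nonneg _
  have hacolLie : IsSkewLie (a ⊓ col) :=
    ⟨fun X hX => hN.skew X hX.1.1, fun X hX Y hY => ⟨habr X hX.1 Y hY.1,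
      fun j _ => hbrcol X ⟨hX.1.1, hX.2⟩ Y ⟨hY.1.1, hY.2⟩ j⟩⟩
  have hacol : ∀ A ∈ a, A ∈ col := by
    intro A hA
    obtain ⟨_, ⟨X, hX, rfl⟩, c, hc⟩ := exists_mem_add_scalar
      (hacolLie.map_blockOne fun X hX => hb X hX.1.1) hα (by
        intro X Y hX hY _ _
        obtain ⟨A, hA, c, hc⟩ := hlifta X hX
        obtain ⟨A', hA', c', hc'⟩ := hlifta Y hY
        obtain ⟨s, t, hst, hcol⟩ := hdep A hA A' hA'
        refine ⟨s, t, hst, _, ⟨_, ⟨a.add_mem (a.smul_mem s hA) (a.smul_mem t hA'), hcol⟩, rfl⟩, ?_⟩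
        intro i j hij
        rw [map_add, map_smul, map_smul, hc, hc']
        simp [hij]) (blockOne_skew (hN.skew A hA.1))
    have : X - A = 0 := by
      refine hab0 _ (a.sub_mem hX.1 hA) (hbmem _ (N.sub_mem hX.1.1 hA.1) c ?_)
      rw [map_sub, hc]; abel
    rw [← sub_eq_zero.1 this]
    exact hX.2
  obtain ⟨A, hA, c, hc⟩ := hlifta S hS
  obtain ⟨A', hA', c', hc'⟩ := hlifta T hT
  set C := A * A' - A' * A with hC
  have hCa : C ∈ a := habr A hA A' hA'
  have hC1 : blockOne C = S * T - T * S := by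
    rw [hC, map_sub, (hb A hA.1).blockOne_mul (hb A' hA'.1), (hb A' hA'.1).blockOne_mul (hb A hA.1),
      hc, hc']
    exact bracket_add_scalar _ _ _ _
  have hCo : ∀ k, blockTwo C k o = 0 :=
    hbrcol A ⟨hA.1, hacol A hA⟩ A' ⟨hA'.1, hacol A' hA'⟩
  have hC2 : blockTwo C = 0 := by
    ext k j
    by_cases hj : j = o
    · rw [hj]; exact hCo k
    obtain ⟨s, t, hst, B, hB, h⟩ := hcolb (fun l => if l = j then 1 else 0)
      (fun l => if l = j then Complex.I else 0)
    have e : blockTwo C * blockTwo B = blockTwo B * blockTwo C := by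
      rw [← (hb C hCa.1).blockTwo_mul (hb B hB.1), hcomm C hCa B hB,
        (hb B hB.1).blockTwo_mul (hb C hCa.1)]
    have e1 := congrFun (congrFun e k) o
    rw [mul_apply, mul_apply, Finset.sum_eq_zero (s := Finset.univ)
      (f := fun l => blockTwo B k l * blockTwo C l o) (fun l _ => by rw [hCo, mul_zero]),
      Finset.sum_eq_single j] at e1
    · rw [h j hj] at e1
      rcases mul_eq_zero.1 e1 with e1 | e1
      · exact e1
      · exfalso
        have hr := congrArg Complex.re e1
        have hi := congrArg Complex.im e1
        simp at hr hi
        simp [hr, hi] at hst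
    · intro l _ hl
      by_cases hlo : l = o
      · rw [hlo, hCo, zero_mul]
      · rw [h l hlo]; simp [hl]
    · simp
  have := hb C hCa.1
  rw [IsBlockDiag, hC1, hC2] at this
  rw [← this]
  exact hCa.1

end BlockPairs

section AlgebraMain

open Matrix

lemma IsSkewLie.map_reindex {m n : Type*} [Fintype m] [Fintype n] [DecidableEq m] [DecidableEq n]
    {N : Submodule ℝ (Matrix m m ℂ)} (hN : IsSkewLie N) (e : m ≃ n) :
    IsSkewLie (N.map (reindexAlgEquiv ℝ ℂ e).toLinearMap) := by
  constructor
  · rintro _ ⟨X, hX, rfl⟩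
    ext i j
    exact congrFun (congrFun (hN.skew X hX) (e.symm i)) (e.symm j)
  · rintro _ ⟨X, hX, rfl⟩ _ ⟨Y, hY, rfl⟩
    refine ⟨_, hN.bracket X hX Y hY, ?_⟩
    simp only [AlgEquiv.toLinearMap_apply, map_sub, map_mul]

variable {n : Type*} [DecidableEq n]

/-- The elementary skew-Hermitian matrix `z E_ij - z̄ E_ji`. -/
def elemSkew (i j : n) (z : ℂ) : Matrix n n ℂ := single i j z - single j i (star z)

lemma elemSkew_skew (i j : n) (z : ℂ) : (elemSkew i j z)ᴴ = -elemSkew i j z := by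
  rw [elemSkew, conjTranspose_sub, conjTranspose_single, conjTranspose_single, star_star, neg_sub]

/-- The skew-Hermitian matrix with off-diagonal part of column `o` equal to `v`, and otherwise
supported on row `o`. -/
def crossSkew (o : n) (v : n → ℂ) : Matrix n n ℂ := of fun i j =>
  if i = j then 0 else if j = o then v i else if i = o then -star (v j) else 0

lemma crossSkew_skew (o : n) (v : n → ℂ) : (crossSkew o v)ᴴ = -crossSkew o v := by
  ext i j
  simp only [conjTranspose_apply, crossSkew, of_apply, Matrix.neg_apply]
  by_cases hij : i = j
  · simp [hij]
  · rw [if_neg hij, if_neg (Ne.symm hij)]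
    by_cases hi : i = o
    · have : j ≠ o := fun h => hij (hi.trans h.symm)
      simp [hi, this]
    · by_cases hj : j = o <;> simp [hi, hj]

lemma crossSkew_apply {o : n} (v : n → ℂ) {j : n} (hj : j ≠ o) : crossSkew o v j o = v j := by
  simp [crossSkew, hj]

lemma crossSkew_diag (o : n) (v : n → ℂ) (j : n) : crossSkew o v j j = 0 := by
  simp [crossSkew]

variable [Fintype n]

/-- If the orthogonal complement of `L` consists of scalars, then `L` contains `𝔰𝔲(n)`. -/
lemma mem_of_skewOrth_scalar {L : Submodule ℝ (Matrix n n ℂ)} (hL : IsSkewLie L)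
    (h : ∀ B ∈ skewOrth L, ∃ b : ℂ, B = b • 1) {X : Matrix n n ℂ} (hX : Xᴴ = -X)
    (htr : X.trace = 0) : X ∈ L := by
  obtain ⟨A, hA, B, hB, rfl⟩ := Submodule.mem_sup.1 (skewSub_le_sup hL hX)
  obtain ⟨b, hb⟩ := h B hB
  have h1 : frobForm B (A + B) = 0 := by
    rw [hb, ← hb, frobForm_apply, hb, conjTranspose_smul, conjTranspose_one, smul_mul_assoc,
      Matrix.one_mul, trace_smul, ← hb, htr]
    simp
  rw [map_add, frobForm_comm, (mem_skewOrth.1 hB).2 A hA, zero_add] at h1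
  rw [eq_zero_of_frobForm_self h1, add_zero]
  exact hA

lemma elemSkew_mul_apply (i j : n) (hij : i ≠ j) (B : Matrix n n ℂ) (a : n) :
    (elemSkew i j 1 * B - B * elemSkew i j 1) i a =
      B j a - (if a = j then B i i else 0) + (if a = i then B i j else 0) := by
  rw [elemSkew, star_one, sub_mul, mul_sub]
  simp only [Matrix.sub_apply]
  rw [single_mul_apply_same, single_mul_apply_of_ne _ _ _ _ _ hij]
  by_cases h1 : a = j
  · subst h1
    rw [mul_single_apply_same, mul_single_apply_of_ne _ _ _ _ _ (Ne.symm hij)]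
    simp [Ne.symm hij]
  · rw [mul_single_apply_of_ne _ _ _ _ _ h1]
    by_cases h2 : a = i
    · subst h2
      rw [mul_single_apply_same]; simp [h1]
    · rw [mul_single_apply_of_ne _ _ _ _ _ h2]; simp [h1, h2]

/-- A Lie algebra containing all commutators of skew-Hermitian matrices contains `𝔰𝔲(n)`. -/
lemma mem_of_commutators {L : Submodule ℝ (Matrix n n ℂ)} (hL : IsSkewLie L)
    (h : ∀ S T : Matrix n n ℂ, Sᴴ = -S → Tᴴ = -T → S * T - T * S ∈ L) {X : Matrix n n ℂ}
    (hX : Xᴴ = -X) (htr : X.trace = 0) : X ∈ L := by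
  refine mem_of_skewOrth_scalar hL (fun B hB => ?_) hX htr
  have hBs := (mem_skewOrth.1 hB).1
  have hc : ∀ S : Matrix n n ℂ, Sᴴ = -S → S * B - B * S = 0 := by
    intro S hS
    apply eq_zero_of_frobForm_self
    rw [frobForm_bracket hS, frobForm_comm,
      (mem_skewOrth.1 hB).2 _ (h S _ hS (bracket_skew hS hBs)), neg_zero]
  rcases isEmpty_or_nonempty n with hn | ⟨⟨k⟩⟩
  · exact ⟨0, Subsingleton.elim _ _⟩
  refine ⟨B k k, ?_⟩
  have hE : ∀ i j, i ≠ j → ∀ a, B j a - (if a = j then B i i else 0) +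
      (if a = i then B i j else 0) = 0 := by
    intro i j hij a
    rw [← elemSkew_mul_apply i j hij, hc _ (elemSkew_skew i j 1), Matrix.zero_apply]
  have hdiag : ∀ j, B j j = B k k := by
    intro j
    by_cases hj : k = j
    · rw [hj]
    · have := hE k j hj j
      simp [Ne.symm hj] at this
      exact sub_eq_zero.1 this
  ext j a
  by_cases hja : j = a
  · subst hja; rw [hdiag]; simp
  · have h1 := hE a j (Ne.symm hja) a
    have h2 : B j a + B a j = 0 := by simpa [Ne.symm hja] using h1
    have hI := congrFun (congrFun (hc (elemSkew a j Complex.I) (elemSkew_skew _ _ _)) a) a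
    rw [elemSkew] at hI
    simp [sub_mul, mul_sub, Ne.symm hja] at hI
    have h3 : B j a - B a j = 0 := by
      have : Complex.I * (B j a - B a j) = 0 := by linear_combination hI
      simpa using this
    have : B j a = 0 := by linear_combination (h2 + h3) / 2
    rw [this]; simp [hja]

lemma card_fin_lt {p r : ℕ} (h : 3 ≤ r) (hr : r ≤ p) :
    3 ≤ Fintype.card {i : Fin p // (i : ℕ) < r} := by
  let f : Fin 3 → {i : Fin p // (i : ℕ) < r} := fun x => ⟨⟨x, by omega⟩, by simp; omega⟩
  have hf : Function.Injective f := by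
    intro x y hxy
    have := congrArg (fun z => (z.1 : ℕ)) hxy
    exact Fin.ext this
  simpa using Fintype.card_le_of_injective f hf

variable {p q : ℕ}

/-- The Lie algebra `g` contains the commutators of the second block. -/
lemma blockTwo_bracket_mem (hq : 5 ≤ q) (hqp : q ≤ p)
    {g : Submodule ℝ (Matrix (Fin p ⊕ Fin q) (Fin p ⊕ Fin q) ℂ)} (hg : IsSkewLie g)
    (hb : ∀ X ∈ g, IsBlockDiag X)
    (H : ∀ (X₁ Y₁ : Matrix (Fin p) (Fin p) ℂ) (X₂ Y₂ : Matrix (Fin q) (Fin q) ℂ),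
      X₁ᴴ = -X₁ → Y₁ᴴ = -Y₁ → X₂ᴴ = -X₂ → Y₂ᴴ = -Y₂ →
      (∀ i, X₁ i i = 0) → (∀ i, Y₁ i i = 0) → (∀ i, X₂ i i = 0) → (∀ i, Y₂ i i = 0) →
      ∃ s t : ℝ, (s ≠ 0 ∨ t ≠ 0) ∧ ∃ Z ∈ g,
        (∀ i j : Fin p, i ≠ j → ((i : ℕ) < q ∨ (j : ℕ) < q) →
          blockOne Z i j = (s • X₁ + t • Y₁) i j) ∧
        ∀ i j, i ≠ j → blockTwo Z i j = (s • X₂ + t • Y₂) i j)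
    {S T : Matrix (Fin q) (Fin q) ℂ} (hS : Sᴴ = -S) (hT : Tᴴ = -T) :
    fromBlocks 0 0 0 (S * T - T * S) ∈ g := by
  let e := Equiv.sumComm (Fin p) (Fin q)
  let o : Fin p := ⟨0, by omega⟩
  have h := fromBlocks_bracket_mem (hg.map_reindex e) (by
      rintro _ ⟨X, hX, rfl⟩
      have := hb X hX
      ext (i | i) (j | j)
      · rfl
      · exact congrFun (congrFun this (Sum.inr i)) (Sum.inl j)
      · exact congrFun (congrFun this (Sum.inl i)) (Sum.inr j)
      · rfl) (by simp; omega) o (by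
      intro X Y hX hY hX0 hY0 v w
      obtain ⟨s, t, hst, Z, hZ, h1, h2⟩ := H (crossSkew o v) (crossSkew o w) X Y
        (crossSkew_skew _ _) (crossSkew_skew _ _) hX hY (crossSkew_diag _ _) (crossSkew_diag _ _)
        hX0 hY0
      refine ⟨s, t, hst, _, ⟨Z, hZ, rfl⟩, h2, fun j hj => ?_⟩
      refine (h1 j o hj (Or.inr (by simp [o]; omega))).trans ?_
      simp [crossSkew_apply _ hj]) hS hT
  obtain ⟨X, hX, hXe⟩ := h
  have : X = fromBlocks 0 0 0 (S * T - T * S) := by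
    ext (i | i) (j | j)
    · exact congrFun (congrFun hXe (Sum.inr i)) (Sum.inr j)
    · exact congrFun (congrFun hXe (Sum.inr i)) (Sum.inl j)
    · exact congrFun (congrFun hXe (Sum.inl i)) (Sum.inr j)
    · exact congrFun (congrFun hXe (Sum.inl i)) (Sum.inl j)
  rwa [← this]

/-- The projection of `g` to the first block contains the commutators of
matrices supported on the first `q - 1` indices. -/
lemma corner_bracket_mem (hq : 5 ≤ q) (hqp : q ≤ p)
    {g : Submodule ℝ (Matrix (Fin p) (Fin p) ℂ)} (hg : IsSkewLie g)
    (H : ∀ X Y : Matrix (Fin p) (Fin p) ℂ, Xᴴ = -X → Yᴴ = -Y →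
      (∀ i, X i i = 0) → (∀ i, Y i i = 0) →
      ∃ s t : ℝ, (s ≠ 0 ∨ t ≠ 0) ∧ ∃ Z ∈ g,
        ∀ i j : Fin p, i ≠ j → ((i : ℕ) < q ∨ (j : ℕ) < q) → Z i j = (s • X + t • Y) i j)
    {S T : Matrix {i : Fin p // (i : ℕ) < q - 1} {i : Fin p // (i : ℕ) < q - 1} ℂ}
    (hS : Sᴴ = -S) (hT : Tᴴ = -T) :
    reindex (Equiv.sumCompl _) (Equiv.sumCompl _) (fromBlocks (S * T - T * S) 0 0 0) ∈ g := by
  let e := (Equiv.sumCompl (fun i : Fin p => (i : ℕ) < q - 1)).symm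
  let N : Submodule ℝ (Matrix (Fin p) (Fin p) ℂ) := g ⊓
    { carrier := {X | IsBlockDiag (reindexAlgEquiv ℝ ℂ e X)}
      add_mem' := by
        intro X Y hX hY
        simp only [Set.mem_ofPred_eq, IsBlockDiag, map_add] at *
        conv_lhs => rw [hX, hY]
        rw [fromBlocks_add, add_zero, add_zero]
      zero_mem' := by
        simp only [Set.mem_ofPred_eq, IsBlockDiag, map_zero, fromBlocks_zero]
      smul_mem' := by
        intro c X hX
        simp only [Set.mem_ofPred_eq, IsBlockDiag, map_smul] at *
        conv_lhs => rw [hX]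
        rw [fromBlocks_smul, smul_zero, smul_zero] }
  have hN : IsSkewLie N := by
    refine ⟨fun X hX => hg.skew X hX.1, fun X hX Y hY => ⟨hg.bracket X hX.1 Y hY.1, ?_⟩⟩
    have h1 : IsBlockDiag (reindexAlgEquiv ℝ ℂ e X) := hX.2
    have h2 : IsBlockDiag (reindexAlgEquiv ℝ ℂ e Y) := hY.2
    change IsBlockDiag (reindexAlgEquiv ℝ ℂ e (X * Y - Y * X))
    rw [IsBlockDiag, map_sub, map_mul, map_mul, map_sub, map_sub, h1.blockOne_mul h2,
      h2.blockOne_mul h1, h1.blockTwo_mul h2, h2.blockTwo_mul h1]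
    conv_lhs => rw [h1, h2]
    rw [fromBlocks_multiply, fromBlocks_multiply, sub_eq_add_neg, fromBlocks_neg,
      fromBlocks_add]
    simp [sub_eq_add_neg]
  let o : {i : Fin p // ¬ (i : ℕ) < q - 1} := ⟨⟨q - 1, by omega⟩, by simp⟩
  have ho : ((o : Fin p) : ℕ) < q := by simp [o]; omega
  have h := fromBlocks_bracket_mem (hN.map_reindex e) (by
      rintro _ ⟨X, hX, rfl⟩
      exact hX.2) (card_fin_lt (by omega) (by omega)) o (by
      intro X Y hX hY hX0 hY0 v w
      have hsk : ∀ (X : Matrix {i : Fin p // (i : ℕ) < q - 1} {i : Fin p // (i : ℕ) < q - 1} ℂ) v,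
          Xᴴ = -X → ((reindexAlgEquiv ℝ ℂ e).symm (fromBlocks X 0 0 (crossSkew o v)))ᴴ =
            -(reindexAlgEquiv ℝ ℂ e).symm (fromBlocks X 0 0 (crossSkew o v)) := by
        intro X v hX
        have : (fromBlocks X 0 0 (crossSkew o v))ᴴ = -fromBlocks X 0 0 (crossSkew o v) := by
          rw [fromBlocks_conjTranspose, hX, crossSkew_skew, fromBlocks_neg]; simp
        ext i j
        exact congrFun (congrFun this (e i)) (e j)
      have hd : ∀ (X : Matrix {i : Fin p // (i : ℕ) < q - 1} {i : Fin p // (i : ℕ) < q - 1} ℂ) v,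
          (∀ i, X i i = 0) →
          ∀ i, (reindexAlgEquiv ℝ ℂ e).symm (fromBlocks X 0 0 (crossSkew o v)) i i = 0 := by
        intro X v hX i
        change fromBlocks X 0 0 (crossSkew o v) (e i) (e i) = 0
        rcases e i with j | j
        · exact hX j
        · exact crossSkew_diag o v j
      obtain ⟨s, t, hst, Z, hZ, h1⟩ := H _ _ (hsk X v hX) (hsk Y w hY) (hd X v hX0) (hd Y w hY0)
      have h1' : ∀ a b, a ≠ b → ((e.symm a : ℕ) < q ∨ (e.symm b : ℕ) < q) →
          reindexAlgEquiv ℝ ℂ e Z a b =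
          (s • fromBlocks X 0 0 (crossSkew o v) + t • fromBlocks Y 0 0 (crossSkew o w)) a b := by
        intro a b hab hlt
        refine (h1 (e.symm a) (e.symm b) (fun h => hab (e.symm.injective h)) hlt).trans ?_
        simp
      have hl : ∀ a : {i : Fin p // (i : ℕ) < q - 1}, ((e.symm (Sum.inl a) : Fin p) : ℕ) < q := by
        intro a
        have : ((e.symm (Sum.inl a) : Fin p) : ℕ) < q - 1 := a.2
        omega
      have hZN : Z ∈ N := by
        refine ⟨hZ, ?_⟩
        change IsBlockDiag (reindexAlgEquiv ℝ ℂ e Z)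
        rw [IsBlockDiag]
        ext (i | i) (j | j)
        · rfl
        · rw [h1' _ _ (by simp) (Or.inl (hl i))]; simp
        · rw [h1' _ _ (by simp) (Or.inr (hl j))]; simp
        · rfl
      refine ⟨s, t, hst, _, ⟨Z, hZN, rfl⟩, fun i j hij => ?_, fun j hj => ?_⟩
      · refine (h1' (Sum.inl i) (Sum.inl j) (by simpa using hij) (Or.inl (hl i))).trans ?_
        simp
      · refine (h1' (Sum.inr j) (Sum.inr o) (by simpa using hj) (Or.inr ho)).trans ?_
        simp [crossSkew_apply _ hj]) hS hT
  obtain ⟨X, hX, hXe⟩ := h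
  have : X = reindex e.symm e.symm (fromBlocks (S * T - T * S) 0 0 0) := by
    rw [← hXe]
    ext i j
    simp
  rw [this] at hX
  exact hX.1

/-- A Lie algebra as in `corner_bracket_mem` contains `𝔰𝔲(p)`. -/
lemma mem_of_offDiag (hq : 5 ≤ q) (hqp : q ≤ p)
    {g : Submodule ℝ (Matrix (Fin p) (Fin p) ℂ)} (hg : IsSkewLie g)
    (H : ∀ X Y : Matrix (Fin p) (Fin p) ℂ, Xᴴ = -X → Yᴴ = -Y →
      (∀ i, X i i = 0) → (∀ i, Y i i = 0) →
      ∃ s t : ℝ, (s ≠ 0 ∨ t ≠ 0) ∧ ∃ Z ∈ g,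
        ∀ i j : Fin p, i ≠ j → ((i : ℕ) < q ∨ (j : ℕ) < q) → Z i j = (s • X + t • Y) i j)
    {X : Matrix (Fin p) (Fin p) ℂ} (hX : Xᴴ = -X) (htr : X.trace = 0) : X ∈ g := by
  have hdiag : ∀ i k : Fin p, (i : ℕ) < q - 1 → (k : ℕ) < q - 1 → i ≠ k →
      diagonal (fun a => Complex.I * ((if a = i then 1 else if a = k then -1 else 0 : ℝ) : ℂ)) ∈ g
      := by
    intro i k hi hk hik
    have h := corner_bracket_mem hq hqp hg H (elemSkew_skew ⟨i, hi⟩ ⟨k, hk⟩ 1)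
      (elemSkew_skew ⟨i, hi⟩ ⟨k, hk⟩ Complex.I)
    have hik' : (⟨i, hi⟩ : {i : Fin p // (i : ℕ) < q - 1}) ≠ ⟨k, hk⟩ := by
      simpa using hik
    have e : elemSkew (⟨i, hi⟩ : {i : Fin p // (i : ℕ) < q - 1}) ⟨k, hk⟩ 1 *
        elemSkew ⟨i, hi⟩ ⟨k, hk⟩ Complex.I -
        elemSkew ⟨i, hi⟩ ⟨k, hk⟩ Complex.I * elemSkew ⟨i, hi⟩ ⟨k, hk⟩ 1 =
        diagonal (fun a => 2 * (Complex.I *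
          ((if a.1 = i then 1 else if a.1 = k then -1 else 0 : ℝ) : ℂ))) := by
      ext a b
      rw [elemSkew, elemSkew]
      simp only [mul_sub, sub_mul, single_mul_single_same, ne_eq, hik', hik'.symm,
        not_false_eq_true, single_mul_single_of_ne, Matrix.sub_apply, single_apply, diagonal_apply,
        Subtype.ext_iff, Matrix.zero_apply]
      by_cases ha : a.1 = i
      · by_cases hb : b.1 = i
        · have : a.1 = b.1 := ha.trans hb.symm
          simp [ha, hb, hik.symm]; ring
        · simp [ha, Ne.symm hb, hik.symm]
      · by_cases hak : a.1 = k
        · by_cases hb : b.1 = k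
          · simp [hak, hb, hik, hik.symm]; ring
          · simp [hak, Ne.symm hb, hik]
        · simp [Ne.symm ha, Ne.symm hak, ha, hak]
    rw [e] at h
    have h2 := g.smul_mem (1 / 2 : ℝ) h
    convert h2 using 1
    ext a b
    obtain ⟨a, rfl⟩ := (Equiv.sumCompl fun i : Fin p => (i : ℕ) < q - 1).surjective a
    obtain ⟨b, rfl⟩ := (Equiv.sumCompl fun i : Fin p => (i : ℕ) < q - 1).surjective b
    rw [Matrix.smul_apply, reindex_apply, submatrix_apply, Equiv.symm_apply_apply,
      Equiv.symm_apply_apply, diagonal_apply]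
    have hne : ∀ x : {i : Fin p // ¬ (i : ℕ) < q - 1}, x.1 ≠ i ∧ x.1 ≠ k :=
      fun x => ⟨fun h => x.2 (h ▸ hi), fun h => x.2 (h ▸ hk)⟩
    rcases a with a | a <;> rcases b with b | b
    · by_cases hab : a = b
      · simp [hab]
      · have : a.1 ≠ b.1 := fun h => hab (Subtype.ext h)
        simp [hab, this]
    · have : a.1 ≠ b.1 := fun h => b.2 (h ▸ a.2)
      simp [this]
    · have : a.1 ≠ b.1 := fun h => a.2 (h ▸ b.2)
      simp [this]
    · simp [(hne a).1, (hne a).2]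
  have hoff : ∀ B ∈ skewOrth g, ∀ i j : Fin p, (i : ℕ) < q - 1 → i ≠ j → B i j = 0 := by
    intro B hB i j hi hij
    obtain ⟨k, hk, hki, hkj⟩ : ∃ k : Fin p, (k : ℕ) < q - 1 ∧ k ≠ i ∧ k ≠ j := by
      have hc := card_fin_lt (p := p) (r := q - 1) (by omega) (by omega)
      by_contra hne
      push Not at hne
      have : (Finset.univ.filter fun a : Fin p => (a : ℕ) < q - 1) ⊆ {i, j} := by
        intro a ha
        simp only [Finset.mem_filter, Finset.mem_univ, true_and] at ha
        by_cases h : a = i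
        · simp [h]
        · simp [hne a ha h]
      have := (Finset.card_le_card this).trans Finset.card_le_two
      rw [Fintype.card_subtype] at hc
      omega
    set d : Fin p → ℝ := fun a => if a = i then 1 else if a = k then -1 else 0 with hd
    have hS := hdiag i k hi hk hki.symm
    set D : Matrix (Fin p) (Fin p) ℂ := diagonal (fun a => Complex.I * (d a : ℂ)) with hD
    have hT := bracket_mem_skewOrth hg hS hB
    have hT' := bracket_mem_skewOrth hg hS hT
    set T := D * B - B * D with hTd
    set T' := D * T - T * D with hTd'
    have hTe : ∀ a b, T a b = Complex.I * (d a - d b) * B a b := by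
      intro a b
      rw [hTd, Matrix.sub_apply, hD, diagonal_mul, mul_diagonal]; ring
    have hTe' : ∀ a b, T' a b = -(d a - d b) * (d a - d b) * B a b := by
      intro a b
      rw [hTd', Matrix.sub_apply, hD, diagonal_mul, mul_diagonal, hTe]
      linear_combination ((d a : ℂ) - d b) * (d a - d b) * B a b * Complex.I_mul_I
    obtain ⟨s, t, hst, Z, hZ, hZe⟩ := H T T' (mem_skewOrth.1 hT).1 (mem_skewOrth.1 hT').1
      (fun a => by rw [hTe]; ring) (fun a => by rw [hTe']; ring)
    have hR : s • T + t • T' ∈ skewOrth g :=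
      Submodule.add_mem _ (Submodule.smul_mem _ _ hT) (Submodule.smul_mem _ _ hT')
    have hRe : ∀ a b, (s • T + t • T') a b =
        (d a - d b) * (s * Complex.I - t * (d a - d b)) * B a b := by
      intro a b
      rw [Matrix.add_apply, Matrix.smul_apply, Matrix.smul_apply, hTe, hTe', Complex.real_smul,
        Complex.real_smul]
      ring
    have hd0 : ∀ a : Fin p, ¬ (a : ℕ) < q → d a = 0 := by
      intro a ha
      have h1 : a ≠ i := by rintro rfl; omega
      have h2 : a ≠ k := by rintro rfl; omega
      simp [hd, h1, h2]
    have h0 : s • T + t • T' = 0 := by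
      apply eq_zero_of_frobForm_self
      have e2 : frobForm (s • T + t • T' - Z) (s • T + t • T') = 0 := by
        apply frobForm_eq_zero_of_disjoint
        intro a b
        by_cases hab : a = b
        · right; rw [hRe, hab]; ring
        · by_cases hlt : (a : ℕ) < q ∨ (b : ℕ) < q
          · left; rw [Matrix.sub_apply, hZe a b hab hlt, sub_self]
          · push Not at hlt
            right; rw [hRe, hd0 a (by omega), hd0 b (by omega)]; simp
      rw [map_sub, LinearMap.sub_apply, (mem_skewOrth.1 hR).2 Z hZ, sub_zero] at e2
      exact e2
    have h1 := hRe i j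
    have hdi : d i = 1 := by simp [hd]
    have hdj : d j = 0 := by simp [hd, hij.symm, hkj.symm]
    rw [h0, hdi, hdj, Matrix.zero_apply] at h1
    have h2 : ((s : ℂ) * Complex.I - t) * B i j = 0 := by
      rw [h1]; push_cast; ring
    rcases mul_eq_zero.1 h2 with h | h
    · exfalso
      have hr := congrArg Complex.re h
      have hi := congrArg Complex.im h
      simp at hr hi
      simp [hr, hi] at hst
    · exact h
  have helem : ∀ i j : Fin p, (i : ℕ) < q - 1 → i ≠ j → elemSkew i j 1 ∈ g := by
    intro i j hi hij
    obtain ⟨A, hA, B, hB, hAB⟩ := Submodule.mem_sup.1 (skewSub_le_sup hg (elemSkew_skew i j 1))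
    have h1 : frobForm B (elemSkew i j 1) = 0 := by
      apply frobForm_eq_zero_of_disjoint
      intro a b
      by_cases hab : a = i ∧ b = j
      · left; rw [hab.1, hab.2]; exact hoff B hB i j hi hij
      · by_cases hab' : a = j ∧ b = i
        · left; rw [hab'.1, hab'.2, skew_apply (mem_skewOrth.1 hB).1, hoff B hB i j hi hij]; simp
        · right
          rw [elemSkew, Matrix.sub_apply, single_apply_of_ne, single_apply_of_ne, sub_zero]
          · rintro ⟨rfl, rfl⟩; exact hab' ⟨rfl, rfl⟩
          · rintro ⟨rfl, rfl⟩; exact hab ⟨rfl, rfl⟩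
    rw [← hAB, map_add, frobForm_comm, (mem_skewOrth.1 hB).2 A hA, zero_add] at h1
    rw [← hAB, eq_zero_of_frobForm_self h1, add_zero]
    exact hA
  refine mem_of_skewOrth_scalar hg (fun B hB => ?_) hX htr
  let i : Fin p := ⟨0, by omega⟩
  have hi : (i : ℕ) < q - 1 := by simp [i]; omega
  refine ⟨B i i, ?_⟩
  ext j a
  by_cases hij : i = j
  · subst hij
    by_cases hia : i = a
    · subst hia; simp
    · rw [hoff B hB i a hi hia]; simp [hia]
  · have h := bracket_mem_skewOrth hg (helem i j hi hij) hB
    by_cases hia : i = a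
    · subst hia
      rw [skew_apply (mem_skewOrth.1 hB).1, hoff B hB i j hi hij]; simp [Ne.symm hij]
    · have h1 := hoff _ h i a hi hia
      rw [elemSkew_mul_apply i j hij, if_neg (Ne.symm hia), add_zero] at h1
      by_cases hja : j = a
      · subst hja
        rw [if_pos rfl] at h1
        rw [sub_eq_zero.1 h1]; simp
      · rw [if_neg (Ne.symm hja), sub_zero] at h1
        rw [h1]; simp [hja]

/-- Algebraic form of the main theorem: a Lie subalgebra of `𝔲(p) ⊕ 𝔲(q)` whose sum with the
isotropy algebra has codimension at most one contains `𝔰𝔲(p) ⊕ 𝔰𝔲(q)`. -/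
theorem fromBlocks_mem_of_codim_le_one (hq : 5 ≤ q) (hqp : q ≤ p)
    {g : Submodule ℝ (Matrix (Fin p ⊕ Fin q) (Fin p ⊕ Fin q) ℂ)} (hg : IsSkewLie g)
    (hb : ∀ X ∈ g, IsBlockDiag X)
    (H : ∀ (X₁ Y₁ : Matrix (Fin p) (Fin p) ℂ) (X₂ Y₂ : Matrix (Fin q) (Fin q) ℂ),
      X₁ᴴ = -X₁ → Y₁ᴴ = -Y₁ → X₂ᴴ = -X₂ → Y₂ᴴ = -Y₂ →
      (∀ i, X₁ i i = 0) → (∀ i, Y₁ i i = 0) → (∀ i, X₂ i i = 0) → (∀ i, Y₂ i i = 0) →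
      ∃ s t : ℝ, (s ≠ 0 ∨ t ≠ 0) ∧ ∃ Z ∈ g,
        (∀ i j : Fin p, i ≠ j → ((i : ℕ) < q ∨ (j : ℕ) < q) →
          blockOne Z i j = (s • X₁ + t • Y₁) i j) ∧
        ∀ i j, i ≠ j → blockTwo Z i j = (s • X₂ + t • Y₂) i j)
    {A : Matrix (Fin p) (Fin p) ℂ} {B : Matrix (Fin q) (Fin q) ℂ} (hA : Aᴴ = -A) (hB : Bᴴ = -B)
    (htA : A.trace = 0) (htB : B.trace = 0) : fromBlocks A 0 0 B ∈ g := by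
  let inOne : Matrix (Fin p) (Fin p) ℂ →ₗ[ℝ] Matrix (Fin p ⊕ Fin q) (Fin p ⊕ Fin q) ℂ :=
    { toFun := fun X => fromBlocks X 0 0 0
      map_add' := by intro X Y; simp [fromBlocks_add]
      map_smul' := by intro c X; simp [fromBlocks_smul] }
  let inTwo : Matrix (Fin q) (Fin q) ℂ →ₗ[ℝ] Matrix (Fin p ⊕ Fin q) (Fin p ⊕ Fin q) ℂ :=
    { toFun := fun X => fromBlocks 0 0 0 X
      map_add' := by intro X Y; simp [fromBlocks_add]
      map_smul' := by intro c X; simp [fromBlocks_smul] }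
  have hone : IsSkewLie (g.comap inOne) := by
    refine ⟨fun X hX => blockOne_skew (hg.skew _ hX), fun X hX Y hY => ?_⟩
    have := hg.bracket _ hX _ hY
    rw [Submodule.mem_comap, map_sub]
    simpa [inOne, fromBlocks_multiply] using this
  have htwo : IsSkewLie (g.comap inTwo) := by
    refine ⟨fun X hX => blockTwo_skew (hg.skew _ hX), fun X hX Y hY => ?_⟩
    have := hg.bracket _ hX _ hY
    rw [Submodule.mem_comap, map_sub]
    simpa [inTwo, fromBlocks_multiply] using this
  have hsuTwo : ∀ B : Matrix (Fin q) (Fin q) ℂ, Bᴴ = -B → B.trace = 0 →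
      fromBlocks 0 0 0 B ∈ g := fun B hB htB =>
    mem_of_commutators htwo (fun S T hS hT => blockTwo_bracket_mem hq hqp hg hb H hS hT) hB htB
  have hsuOne : ∀ A : Matrix (Fin p) (Fin p) ℂ, Aᴴ = -A → A.trace = 0 →
      ∃ Z ∈ g, blockOne Z = A := fun A hA htA =>
    mem_of_offDiag hq hqp (hg.map_blockOne hb) (by
      intro X Y hX hY hX0 hY0
      obtain ⟨s, t, hst, Z, hZ, h1, -⟩ := H X Y 0 0 hX hY (by simp) (by simp) hX0 hY0
        (by simp) (by simp)
      exact ⟨s, t, hst, _, ⟨Z, hZ, rfl⟩, h1⟩) hA htA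
  have hsplit : ∀ {r : ℕ}, 0 < r → ∀ S : Matrix (Fin r) (Fin r) ℂ, Sᴴ = -S →
      ∃ S₀ : Matrix (Fin r) (Fin r) ℂ, ∃ c : ℝ, S₀ᴴ = -S₀ ∧ S₀.trace = 0 ∧
        S = S₀ + c • (Complex.I • (1 : Matrix _ _ ℂ)) := by
    intro r hr S hS
    have hre : S.trace.re = 0 := by
      have := congrArg (fun X => (trace X).re) hS
      simp [trace_conjTranspose] at this
      linarith
    refine ⟨S - (S.trace.im / r) • (Complex.I • (1 : Matrix _ _ ℂ)), S.trace.im / r, ?_, ?_,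
      by abel⟩
    · rw [conjTranspose_sub, hS, conjTranspose_smul, conjTranspose_smul]
      simp only [star_trivial, Complex.star_def, Complex.conj_I, conjTranspose_one, neg_smul,
        smul_neg]
      abel
    · have hr' : (r : ℂ) ≠ 0 := by exact_mod_cast hr.ne'
      apply Complex.ext
      · simp [trace_sub, hre]
      · have hr' : (r : ℝ) ≠ 0 := by exact_mod_cast hr.ne'
        simp [trace_sub]
        field_simp
        simp
  have hlift : ∀ S : Matrix (Fin p) (Fin p) ℂ, Sᴴ = -S → ∃ S₀ : Matrix (Fin p) (Fin p) ℂ,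
      ∃ c d : ℝ, S = S₀ + c • (Complex.I • (1 : Matrix _ _ ℂ)) ∧
        fromBlocks S₀ 0 0 (0 + d • (Complex.I • (1 : Matrix (Fin q) (Fin q) ℂ))) ∈ g := by
    intro S hS
    obtain ⟨S₀, c, hS₀, ht, rfl⟩ := hsplit (by omega) S hS
    obtain ⟨Z, hZ, rfl⟩ := hsuOne S₀ hS₀ ht
    obtain ⟨D, d, hD, htD, hZD⟩ := hsplit (by omega) (blockTwo Z) (blockTwo_skew (hg.skew Z hZ))
    refine ⟨blockOne Z, c, d, rfl, ?_⟩
    have := g.sub_mem hZ (hsuTwo D hD htD)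
    convert this using 1
    conv_rhs => rw [hb Z hZ, hZD]
    rw [sub_eq_add_neg, fromBlocks_neg, fromBlocks_add]
    simp
  have h1 : fromBlocks A 0 0 0 ∈ g := by
    refine mem_of_commutators hone (fun S T hS hT => ?_) hA htA
    obtain ⟨S₀, c, d, rfl, h⟩ := hlift S hS
    obtain ⟨T₀, c', d', rfl, h'⟩ := hlift T hT
    rw [bracket_add_scalar]
    have := hg.bracket _ h _ h'
    rw [fromBlocks_multiply, fromBlocks_multiply, sub_eq_add_neg, fromBlocks_neg,
      fromBlocks_add] at this
    have hz := bracket_add_scalar (0 : Matrix (Fin q) (Fin q) ℂ) 0 d d'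
    rw [sub_eq_add_neg] at hz
    simp only [Matrix.mul_zero, Matrix.zero_mul, add_zero, zero_add, neg_zero] at this hz
    rw [hz, ← sub_eq_add_neg, sub_zero] at this
    exact this
  have := g.add_mem h1 (hsuTwo B hB htB)
  simpa [fromBlocks_add] using this

end AlgebraMain

section ClosedUnitaryGroups

open Filter Topology NormedSpace

section RealExponential

variable {A : Type*} [NormedRing A] [NormedAlgebra ℝ A]

lemma tendsto_smul_sub_one_of_hasDerivAt {c : ℝ → A} {w : A} (hc : HasDerivAt c w 0)
    (h0 : c 0 = 1) {ι : Type*} {l : Filter ι} {r : ι → ℝ} (hr : Tendsto r l (𝓝 0))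
    (hr0 : ∀ᶠ i in l, 0 < r i) : Tendsto (fun i => (r i)⁻¹ • (c (r i) - 1)) l (𝓝 w) := by
  have h := hasDerivAt_iff_tendsto_slope_zero.1 hc
  have h' : Tendsto r l (𝓝[≠] 0) :=
    tendsto_nhdsWithin_iff.2 ⟨hr, hr0.mono fun i hi => ne_of_gt hi⟩
  simpa [h0, Function.comp_def] using h.comp h'

lemma exists_tendsto_of_norm_le_one [FiniteDimensional ℝ A] {ι : Type*} (l : Ultrafilter ι)
    {u : ι → A} (hu : ∀ᶠ i in (l : Filter ι), ‖u i‖ ≤ 1) : ∃ Y, Tendsto u l (𝓝 Y) := by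
  have : ProperSpace A := FiniteDimensional.proper ℝ A
  obtain ⟨Y, -, hY⟩ := (isCompact_closedBall (0 : A) 1).ultrafilter_le_nhds (l.map u)
    (le_principal_iff.2 (hu.mono fun i hi => by simpa using hi))
  exact ⟨Y, hY⟩

variable [CompleteSpace A]

lemma exp_natCast_mul_smul (m : ℕ) (r : ℝ) (X : A) : exp ((m * r) • X) = exp (r • X) ^ m := by
  let _ : NormedAlgebra ℚ A := NormedAlgebra.restrictScalars ℚ ℝ A
  rw [← exp_nsmul, mul_smul, Nat.cast_smul_eq_nsmul]

lemma continuous_real_exp : Continuous (exp : A → A) := by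
  let _ : NormedAlgebra ℚ A := NormedAlgebra.restrictScalars ℚ ℝ A
  exact exp_continuous

lemma hasDerivAt_exp_smul_zero (X : A) : HasDerivAt (fun t : ℝ => exp (t • X)) X 0 := by
  simpa using hasDerivAt_exp_smul_const (𝕂 := ℝ) X (0 : ℝ)

lemma exp_mul_mul_eq {u v : A} (huv : u * v = 1) (hvu : v * u = 1) (X : A) :
    exp (u * X * v) = u * exp X * v := by
  let _ : NormedAlgebra ℚ A := NormedAlgebra.restrictScalars ℚ ℝ A
  exact exp_units_conj (⟨u, v, huv, hvu⟩ : Aˣ) X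

end RealExponential

variable {A : Type*} [NormedRing A] [StarRing A]

/-- A closed subgroup of the group of unitary elements of a normed star ring. -/
structure IsClosedUnitaryGroup (G : Set A) : Prop where
  one_mem : 1 ∈ G
  mul_mem : ∀ {a b}, a ∈ G → b ∈ G → a * b ∈ G
  star_mem : ∀ {a}, a ∈ G → star a ∈ G
  mul_star_self : ∀ {a}, a ∈ G → a * star a = 1
  star_mul_self : ∀ {a}, a ∈ G → star a * a = 1
  isClosed : IsClosed G

lemma IsClosedUnitaryGroup.pow_mem {G : Set A} (hG : IsClosedUnitaryGroup G) {a : A} (ha : a ∈ G)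
    (m : ℕ) : a ^ m ∈ G := by
  induction m with
  | zero => simpa using hG.one_mem
  | succ k ih => rw [pow_succ]; exact hG.mul_mem ih ha

/-- The conjugate `k⁻¹ G k` of a closed unitary group. -/
lemma IsClosedUnitaryGroup.conj {G : Set A} [ContinuousStar A] (hG : IsClosedUnitaryGroup G)
    {k : A} (hk : k * star k = 1) (hk' : star k * k = 1) :
    IsClosedUnitaryGroup {a | k * a * star k ∈ G} := by
  have key : ∀ a : A, star k * (k * a * star k) * k = a := fun a => by
    rw [mul_assoc k a, ← mul_assoc (star k) k, hk', one_mul, mul_assoc, hk', mul_one]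
  have hmul : ∀ a b : A, k * (a * b) * star k = k * a * star k * (k * b * star k) := fun a b => by
    calc k * (a * b) * star k = k * a * 1 * b * star k := by simp [mul_assoc]
      _ = _ := by rw [← hk']; simp only [mul_assoc]
  have hstar : ∀ a : A, k * star a * star k = star (k * a * star k) := fun a => by
    simp [mul_assoc]
  have hinj : ∀ a b : A, k * a * star k = k * b * star k → a = b := fun a b h => by
    rw [← key a, h, key b]
  have h1 : k * 1 * star k = 1 := by rw [mul_one, hk]
  refine ⟨?_, ?_, ?_, ?_, ?_, ?_⟩
  · change k * 1 * star k ∈ G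
    rw [h1]
    exact hG.one_mem
  · intro a b ha hb
    change k * (a * b) * star k ∈ G
    rw [hmul]
    exact hG.mul_mem ha hb
  · intro a ha
    change k * star a * star k ∈ G
    rw [hstar]
    exact hG.star_mem ha
  · intro a ha
    refine hinj _ _ ?_
    rw [hmul, hstar, h1]
    exact hG.mul_star_self ha
  · intro a ha
    refine hinj _ _ ?_
    rw [hmul, hstar, h1]
    exact hG.star_mul_self ha
  · exact hG.isClosed.preimage (by fun_prop)

variable [CStarRing A]

section Norm

variable [Nontrivial A]

lemma norm_eq_one_of_mul_star {a : A} (h1 : a * star a = 1) (h2 : star a * a = 1) : ‖a‖ = 1 :=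
  CStarRing.norm_of_mem_unitary (Unitary.mem_iff.2 ⟨h2, h1⟩)

lemma IsClosedUnitaryGroup.norm_eq_one {G : Set A} (hG : IsClosedUnitaryGroup G) {a : A}
    (ha : a ∈ G) : ‖a‖ = 1 :=
  norm_eq_one_of_mul_star (hG.mul_star_self ha) (hG.star_mul_self ha)

lemma IsClosedUnitaryGroup.isCompact [NormedAlgebra ℝ A] [FiniteDimensional ℝ A]
    {G : Set A} (hG : IsClosedUnitaryGroup G) :
    IsCompact G := by
  have : ProperSpace A := FiniteDimensional.proper ℝ A
  refine Metric.isCompact_of_isClosed_isBounded hG.isClosed ?_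
  refine (Metric.isBounded_closedBall (x := (0 : A)) (r := 1)).subset fun a ha => ?_
  simpa using (hG.norm_eq_one ha).le

/-- The factorization `x = g * h⁻¹` can be chosen with `g`, `h` as close to `1` as possible. -/
lemma IsClosedUnitaryGroup.exists_minimal_factorization [NormedAlgebra ℝ A]
    [FiniteDimensional ℝ A] {G H : Set A}
    (hG : IsClosedUnitaryGroup G) (hH : IsClosedUnitaryGroup H) {x : A}
    (hx : ∃ g ∈ G, ∃ h ∈ H, x = g * star h) :
    ∃ g ∈ G, ∃ h ∈ H, x = g * star h ∧ ∀ g' ∈ G, ∀ h' ∈ H, x = g' * star h' →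
      ‖g - 1‖ + ‖h - 1‖ ≤ ‖g' - 1‖ + ‖h' - 1‖ := by
  have hcomp : IsCompact ((G ×ˢ H) ∩ {z : A × A | x = z.1 * star z.2}) :=
    (hG.isCompact.prod hH.isCompact).inter_right
      (isClosed_eq continuous_const (by fun_prop))
  obtain ⟨g₀, hg₀, h₀, hh₀, e₀⟩ := hx
  obtain ⟨z, ⟨⟨hz1, hz2⟩, hz3⟩, hmin⟩ := hcomp.exists_isMinOn ⟨(g₀, h₀), ⟨hg₀, hh₀⟩, e₀⟩
    (f := fun z => ‖z.1 - 1‖ + ‖z.2 - 1‖) (by fun_prop)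
  exact ⟨z.1, hz1, z.2, hz2, hz3, fun g' hg' h' hh' e =>
    hmin (show (g', h') ∈ _ from ⟨⟨hg', hh'⟩, e⟩)⟩

lemma norm_pow_sub_pow_le_of_norm_le_one {a b : A} (ha : ‖a‖ ≤ 1) (hb : ‖b‖ ≤ 1) (m : ℕ) :
    ‖a ^ m - b ^ m‖ ≤ m * ‖a - b‖ := by
  have hbm : ∀ m : ℕ, ‖b ^ m‖ ≤ 1 := fun m => by
    induction m with
    | zero => simp
    | succ k ih =>
      rw [pow_succ]
      exact (norm_mul_le _ _).trans (mul_le_one₀ ih (norm_nonneg _) hb)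
  induction m with
  | zero => simp
  | succ k ih =>
    have : a ^ (k + 1) - b ^ (k + 1) = a * (a ^ k - b ^ k) + (a - b) * b ^ k := by
      rw [pow_succ', pow_succ']; noncomm_ring
    rw [this]
    calc ‖a * (a ^ k - b ^ k) + (a - b) * b ^ k‖
        ≤ ‖a‖ * ‖a ^ k - b ^ k‖ + ‖a - b‖ * ‖b ^ k‖ :=
          (norm_add_le _ _).trans (add_le_add (norm_mul_le _ _) (norm_mul_le _ _))
      _ ≤ 1 * (k * ‖a - b‖) + ‖a - b‖ * 1 := by
          gcongr
          exact hbm k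
      _ = (k + 1 : ℕ) * ‖a - b‖ := by push_cast; ring

end Norm

variable [NormedAlgebra ℝ A] [StarModule ℝ A] {G : Set A}

lemma IsClosedUnitaryGroup.star_eq_neg_of_tendsto (hG : IsClosedUnitaryGroup G) {ι : Type*}
    {l : Filter ι} [l.NeBot] {a : ι → A} {r : ι → ℝ} {Y : A} (ha : ∀ᶠ i in l, a i ∈ G)
    (hr0 : ∀ᶠ i in l, 0 < r i) (hr : Tendsto r l (𝓝 0))
    (h : Tendsto (fun i => (r i)⁻¹ • (a i - 1)) l (𝓝 Y)) : star Y = -Y := by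
  set u : ι → A := fun i => (r i)⁻¹ • (a i - 1) with hu
  have h1 : Tendsto (fun i => u i + star (u i) + r i • (u i * star (u i))) l
      (𝓝 (Y + star Y + (0 : ℝ) • (Y * star Y))) :=
    (h.add h.star).add (hr.smul (h.mul h.star))
  have h2 : (fun i => u i + star (u i) + r i • (u i * star (u i))) =ᶠ[l] fun _ => 0 := by
    filter_upwards [ha, hr0] with i hi hri
    have hs : star (u i) = (r i)⁻¹ • (star (a i) - 1) := by simp [hu]
    rw [hs]
    simp only [hu]
    rw [smul_mul_smul_comm, smul_smul]
    have h3 : r i * ((r i)⁻¹ * (r i)⁻¹) = (r i)⁻¹ := by field_simp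
    rw [h3, ← smul_add, ← smul_add]
    have h4 : a i - 1 + (star (a i) - 1) + (a i - 1) * (star (a i) - 1) = a i * star (a i) - 1 := by
      noncomm_ring
    rw [h4, hG.mul_star_self hi, sub_self, smul_zero]
  have h3 := tendsto_nhds_unique (h1.congr' h2) tendsto_const_nhds
  rw [zero_smul, add_zero] at h3
  exact eq_neg_of_add_eq_zero_right h3

variable [Nontrivial A] [CompleteSpace A]

lemma norm_exp_of_skew {X : A} (hX : star X = -X) (t : ℝ) : ‖exp (t • X)‖ = 1 := by
  let _ : NormedAlgebra ℚ A := NormedAlgebra.restrictScalars ℚ ℝ A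
  refine CStarRing.norm_of_mem_unitary (exp_mem_unitary_of_mem_skewAdjoint ?_)
  rw [skewAdjoint.mem_iff, star_smul, hX]
  simp

/-- Limits of rescaled sequences in a closed unitary group generate one-parameter subgroups. -/
theorem IsClosedUnitaryGroup.exp_mem_of_tendsto (hG : IsClosedUnitaryGroup G) {ι : Type*}
    {l : Filter ι} [l.NeBot] {a : ι → A} {r : ι → ℝ} {Y : A} (ha : ∀ᶠ i in l, a i ∈ G)
    (hr0 : ∀ᶠ i in l, 0 < r i) (hr : Tendsto r l (𝓝 0))
    (h : Tendsto (fun i => (r i)⁻¹ • (a i - 1)) l (𝓝 Y)) (t : ℝ) : exp (t • Y) ∈ G := by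
  have hY := hG.star_eq_neg_of_tendsto ha hr0 hr h
  have main : ∀ t : ℝ, 0 ≤ t → exp (t • Y) ∈ G := by
    intro t ht
    set m : ι → ℕ := fun i => ⌊t / r i⌋₊ with hm
    have hmr : ∀ᶠ i in l, m i * r i ≤ t ∧ t - r i ≤ m i * r i := by
      filter_upwards [hr0] with i hi
      have h1 := Nat.floor_le (div_nonneg ht hi.le)
      have h2 := Nat.lt_floor_add_one (t / r i)
      rw [le_div_iff₀ hi] at h1
      rw [div_lt_iff₀ hi] at h2
      exact ⟨h1, by simp only [hm]; linarith⟩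
    have hlim : Tendsto (fun i => m i * r i) l (𝓝 t) :=
      tendsto_of_tendsto_of_tendsto_of_le_of_le' (g := fun i => t - r i) (h := fun _ => t)
        (by simpa using tendsto_const_nhds.sub hr) tendsto_const_nhds
        (hmr.mono fun i hi => hi.2) (hmr.mono fun i hi => hi.1)
    have hexp : Tendsto (fun i => exp ((m i * r i) • Y)) l (𝓝 (exp (t • Y))) :=
      (continuous_real_exp.tendsto _).comp (hlim.smul_const Y)
    have hexp' := tendsto_smul_sub_one_of_hasDerivAt (hasDerivAt_exp_smul_zero Y) (by simp) hr hr0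
    have hz : Tendsto (fun i => t * ‖(r i)⁻¹ • (a i - 1) - (r i)⁻¹ • (exp (r i • Y) - 1)‖) l
        (𝓝 0) := by
      simpa using ((h.sub hexp').norm).const_mul t
    have hdiff : Tendsto (fun i => a i ^ m i - exp ((m i * r i) • Y)) l (𝓝 0) := by
      refine squeeze_zero_norm' ?_ hz
      filter_upwards [ha, hr0, hmr] with i hi hri hmi
      rw [exp_natCast_mul_smul]
      refine (norm_pow_sub_pow_le_of_norm_le_one (hG.norm_eq_one hi).le
        (norm_exp_of_skew hY _).le _).trans ?_
      rw [← smul_sub, sub_sub_sub_cancel_right, norm_smul, norm_inv, Real.norm_of_nonneg hri.le,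
        ← mul_assoc]
      gcongr
      rw [← div_eq_mul_inv, le_div_iff₀ hri]
      exact hmi.1
    have hpow : Tendsto (fun i => a i ^ m i) l (𝓝 (exp (t • Y))) := by
      simpa using hdiff.add hexp
    exact hG.isClosed.mem_of_tendsto hpow (ha.mono fun i hi => hG.pow_mem hi _)
  rcases le_total 0 t with ht | ht
  · exact main t ht
  · have := hG.star_mem (main (-t) (by linarith))
    rwa [star_exp, star_smul, hY, star_trivial, neg_smul_neg] at this

/-- The Lie algebra of a closed unitary group. -/
def IsClosedUnitaryGroup.lie (hG : IsClosedUnitaryGroup G) : Submodule ℝ A where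
  carrier := {X | ∀ t : ℝ, exp (t • X) ∈ G}
  zero_mem' := fun t => by simpa using hG.one_mem
  smul_mem' := fun c X hX t => by
    rw [smul_smul]
    exact hX _
  add_mem' := fun {X Y} hX hY => by
    have hc : HasDerivAt (fun t : ℝ => exp (t • X) * exp (t • Y)) (X + Y) 0 := by
      simpa using (hasDerivAt_exp_smul_zero X).fun_mul (hasDerivAt_exp_smul_zero Y)
    exact hG.exp_mem_of_tendsto (l := 𝓝[>] (0 : ℝ)) (r := id)
      (Eventually.of_forall fun t => hG.mul_mem (hX t) (hY t)) self_mem_nhdsWithin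
      (tendsto_id.mono_left nhdsWithin_le_nhds)
      (tendsto_smul_sub_one_of_hasDerivAt hc (by simp)
        (tendsto_id.mono_left nhdsWithin_le_nhds) self_mem_nhdsWithin)

lemma IsClosedUnitaryGroup.star_of_mem_lie (hG : IsClosedUnitaryGroup G) {X : A}
    (hX : X ∈ hG.lie) : star X = -X :=
  hG.star_eq_neg_of_tendsto (l := 𝓝[>] (0 : ℝ)) (r := id) (Eventually.of_forall hX)
    self_mem_nhdsWithin (tendsto_id.mono_left nhdsWithin_le_nhds)
    (tendsto_smul_sub_one_of_hasDerivAt (hasDerivAt_exp_smul_zero X) (by simp)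
      (tendsto_id.mono_left nhdsWithin_le_nhds) self_mem_nhdsWithin)

lemma IsClosedUnitaryGroup.lie_mono (hG : IsClosedUnitaryGroup G) {H : Set A}
    (hH : IsClosedUnitaryGroup H) (h : G ⊆ H) : hG.lie ≤ hH.lie := fun _ hX t => h (hX t)

lemma IsClosedUnitaryGroup.conj_mem_lie (hG : IsClosedUnitaryGroup G) {u X : A} (hu : u ∈ G)
    (hX : X ∈ hG.lie) : u * X * star u ∈ hG.lie := fun t => by
  rw [← smul_mul_assoc, ← mul_smul_comm, exp_mul_mul_eq (hG.mul_star_self hu) (hG.star_mul_self hu)]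
  exact hG.mul_mem (hG.mul_mem hu (hX t)) (hG.star_mem hu)

lemma IsClosedUnitaryGroup.bracket_mem_lie [FiniteDimensional ℝ A] (hG : IsClosedUnitaryGroup G)
    {X Y : A} (hX : X ∈ hG.lie) (hY : Y ∈ hG.lie) : X * Y - Y * X ∈ hG.lie := by
  have hcl : IsClosed (hG.lie : Set A) := Submodule.closed_of_finiteDimensional _
  have hd : HasDerivAt (fun t : ℝ => exp (t • X) * Y * exp (t • -X)) (X * Y - Y * X) 0 := by
    have := ((hasDerivAt_exp_smul_zero X).mul_const Y).fun_mul (hasDerivAt_exp_smul_zero (-X))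
    simpa [sub_eq_add_neg] using this
  have hmem : ∀ t : ℝ, exp (t • X) * Y * exp (t • -X) ∈ hG.lie := fun t => by
    have := hG.conj_mem_lie (hX t) hY
    rwa [star_exp, star_smul, hG.star_of_mem_lie hX, star_trivial] at this
  have h := hasDerivAt_iff_tendsto_slope_zero.1 hd
  refine hcl.mem_of_tendsto h (Eventually.of_forall fun t => ?_)
  exact hG.lie.smul_mem _ (hG.lie.sub_mem (hmem _) (hmem _))

/-- The velocity at `1` of a curve in `G H⁻¹` lies in the sum of the two Lie algebras. -/
theorem IsClosedUnitaryGroup.velocity_mem_sup_lie [FiniteDimensional ℝ A] {H : Set A}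
    (hG : IsClosedUnitaryGroup G) (hH : IsClosedUnitaryGroup H) {c : ℝ → A} {w : A}
    (hc : ∀ t, ∃ g ∈ G, ∃ h ∈ H, c t = g * star h) (h0 : c 0 = 1) (hd : HasDerivAt c w 0) :
    w ∈ hG.lie ⊔ hH.lie := by
  choose g hg h hh hgh hmin using fun t => hG.exists_minimal_factorization hH (hc t)
  set l : Ultrafilter ℝ := Ultrafilter.of (𝓝[>] (0 : ℝ)) with hl
  have hl0 : (l : Filter ℝ) ≤ 𝓝[>] 0 := Ultrafilter.of_le _
  have hpos : ∀ᶠ t in (l : Filter ℝ), 0 < t := hl0 self_mem_nhdsWithin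
  have hid : Tendsto id (l : Filter ℝ) (𝓝 0) := hl0.trans nhdsWithin_le_nhds
  have hc1 : Tendsto c l (𝓝 1) := h0 ▸ hd.continuousAt.tendsto.comp hid
  have hεlim : Tendsto (fun t => ‖g t - 1‖ + ‖h t - 1‖) l (𝓝 0) := by
    obtain ⟨g₀, hg₀⟩ := exists_tendsto_of_norm_le_one l
      (Eventually.of_forall fun t => (hG.norm_eq_one (hg t)).le)
    obtain ⟨h₀, hh₀⟩ := exists_tendsto_of_norm_le_one l
      (Eventually.of_forall fun t => (hH.norm_eq_one (hh t)).le)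
    have hgG : g₀ ∈ G := hG.isClosed.mem_of_tendsto hg₀ (Eventually.of_forall hg)
    have hhH : h₀ ∈ H := hH.isClosed.mem_of_tendsto hh₀ (Eventually.of_forall hh)
    have h1 : g₀ * star h₀ = 1 :=
      tendsto_nhds_unique ((hg₀.mul hh₀.star).congr fun t => (hgh t).symm) hc1
    have h2 : g₀ = h₀ := by
      have := congrArg (· * h₀) h1
      simpa [mul_assoc, hH.star_mul_self hhH] using this
    subst h2
    have hlim : Tendsto (fun t => ‖g t * star g₀ - 1‖ + ‖h t * star g₀ - 1‖) l (𝓝 0) := by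
      have := (((hg₀.mul_const (star g₀)).sub_const 1).norm).add
        (((hh₀.mul_const (star g₀)).sub_const 1).norm)
      simpa [h1] using this
    refine squeeze_zero (fun t => by positivity) (fun t => ?_) hlim
    refine hmin t _ (hG.mul_mem (hg t) (hG.star_mem hgG)) _
      (hH.mul_mem (hh t) (hH.star_mem hhH)) ?_
    rw [hgh t, star_mul, star_star, mul_assoc (g t), ← mul_assoc (star g₀),
      hG.star_mul_self hgG, one_mul]
  set r : ℝ → ℝ := fun t => t + (‖g t - 1‖ + ‖h t - 1‖) with hr
  have hrpos : ∀ᶠ t in (l : Filter ℝ), 0 < r t := hpos.mono fun t ht => by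
    simp only [hr]; positivity
  have hrlim : Tendsto r l (𝓝 0) := by simpa using hid.add hεlim
  set u : ℝ → A := fun t => (r t)⁻¹ • (g t - 1) with hu
  set v : ℝ → A := fun t => (r t)⁻¹ • (h t - 1) with hv
  have hsum : ∀ᶠ t in (l : Filter ℝ), ‖u t‖ + ‖v t‖ = 1 - t / r t := by
    filter_upwards [hrpos] with t ht
    simp only [hu, hv]
    rw [norm_smul, norm_smul, norm_inv, Real.norm_of_nonneg ht.le]
    field_simp
    simp only [hr]; ring
  have hsum' : ∀ᶠ t in (l : Filter ℝ), ‖u t‖ + ‖v t‖ ≤ 1 := by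
    filter_upwards [hrpos, hpos, hsum] with t ht ht' h
    have := div_pos ht' ht
    linarith
  obtain ⟨Y₁, hY₁⟩ := exists_tendsto_of_norm_le_one l (u := u)
    (hsum'.mono fun t ht => by linarith [norm_nonneg (v t)])
  obtain ⟨Y₂, hY₂⟩ := exists_tendsto_of_norm_le_one l (u := v)
    (hsum'.mono fun t ht => by linarith [norm_nonneg (u t)])
  have hτ : Tendsto (fun t => t / r t) l (𝓝 (1 - (‖Y₁‖ + ‖Y₂‖))) := by
    refine ((hY₁.norm.add hY₂.norm).const_sub 1).congr' ?_
    filter_upwards [hsum] with t ht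
    linarith
  set τ : ℝ := 1 - (‖Y₁‖ + ‖Y₂‖) with hτdef
  have hY₁G : Y₁ ∈ hG.lie := hG.exp_mem_of_tendsto (Eventually.of_forall hg) hrpos hrlim hY₁
  have hY₂H : Y₂ ∈ hH.lie := hH.exp_mem_of_tendsto (Eventually.of_forall hh) hrpos hrlim hY₂
  have hh1 : Tendsto h l (𝓝 1) := by
    have : Tendsto (fun t => r t • v t + 1) l (𝓝 ((0 : ℝ) • Y₂ + 1)) :=
      (hrlim.smul hY₂).add_const 1
    rw [zero_smul, zero_add] at this
    refine this.congr' ?_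
    filter_upwards [hrpos] with t ht
    simp only [hv]
    rw [smul_inv_smul₀ ht.ne', sub_add_cancel]
  have hrel : τ • w = Y₁ - Y₂ := by
    have h1 : Tendsto (fun t => ((t / r t) • (t⁻¹ • (c t - 1))) * h t) l (𝓝 ((τ • w) * 1)) :=
      (hτ.smul (tendsto_smul_sub_one_of_hasDerivAt hd h0 hid hpos)).mul hh1
    rw [mul_one] at h1
    refine tendsto_nhds_unique (h1.congr' ?_) (hY₁.sub hY₂)
    filter_upwards [hrpos, hpos] with t ht ht'
    simp only [hu, hv]
    rw [smul_smul, ← smul_sub, smul_mul_assoc, sub_sub_sub_cancel_right, sub_mul, one_mul, hgh t,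
      mul_assoc, hH.star_mul_self (hh t), mul_one]
    congr 1
    field_simp
  by_cases hτ0 : τ = 0
  · exfalso
    have hY : Y₁ = Y₂ := by
      rw [hτ0, zero_smul] at hrel
      exact (sub_eq_zero.1 hrel.symm)
    set e : ℝ → A := fun t => exp (r t • -Y₁) with he
    have heG : ∀ t, e t ∈ G := hG.lie.neg_mem hY₁G |> fun h t => h (r t)
    have heH : ∀ t, e t ∈ H := by
      rw [← hY] at hY₂H
      exact fun t => hH.lie.neg_mem hY₂H (r t)
    have he1 : Tendsto (fun t => (r t)⁻¹ • (e t - 1)) l (𝓝 (-Y₁)) :=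
      tendsto_smul_sub_one_of_hasDerivAt (hasDerivAt_exp_smul_zero (-Y₁)) (by simp) hrlim hrpos
    have he2 : Tendsto e l (𝓝 1) := by
      have := (continuous_real_exp.tendsto _).comp (hrlim.smul_const (-Y₁))
      simpa [Function.comp_def, he] using this
    have hcmp : Tendsto (fun t => ‖u t * e t + (r t)⁻¹ • (e t - 1)‖ +
        ‖v t * e t + (r t)⁻¹ • (e t - 1)‖) l (𝓝 0) := by
      have := (((hY₁.mul he2).add he1).norm).add (((hY₂.mul he2).add he1).norm)
      simpa [hY] using this
    have hle : ∀ᶠ t in (l : Filter ℝ), ‖u t‖ + ‖v t‖ ≤ ‖u t * e t + (r t)⁻¹ • (e t - 1)‖ +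
        ‖v t * e t + (r t)⁻¹ • (e t - 1)‖ := by
      filter_upwards [hrpos] with t ht
      have h1 := hmin t _ (hG.mul_mem (hg t) (heG t)) _ (hH.mul_mem (hh t) (heH t)) (by
        rw [hgh t, star_mul, mul_assoc (g t), ← mul_assoc (e t), hG.mul_star_self (heG t), one_mul])
      have h2 : ∀ x : A, (r t)⁻¹ • (x - 1) * e t + (r t)⁻¹ • (e t - 1) =
          (r t)⁻¹ • (x * e t - 1) := fun x => by
        rw [smul_mul_assoc, ← smul_add]
        congr 1
        noncomm_ring
      simp only [hu, hv]
      rw [h2, h2]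
      simp only [norm_smul, ← mul_add]
      gcongr
    have h3 := le_of_tendsto_of_tendsto (hY₁.norm.add hY₂.norm) hcmp hle
    linarith
  · have : w = τ⁻¹ • (Y₁ - Y₂) := by rw [← hrel, inv_smul_smul₀ hτ0]
    rw [this]
    exact Submodule.smul_mem _ _ (Submodule.sub_mem _ (Submodule.mem_sup_left hY₁G)
      (Submodule.mem_sup_right hY₂H))

end ClosedUnitaryGroups

lemma exists_combination_mem_of_finrank_le {V : Type*} [AddCommGroup V] [Module ℝ V]
    [FiniteDimensional ℝ V] {U W : Submodule ℝ V} (hWU : W ≤ U)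
    (h : finrank ℝ U ≤ finrank ℝ W + 1) {x y : V} (hx : x ∈ U) (hy : y ∈ U) :
    ∃ s t : ℝ, (s ≠ 0 ∨ t ≠ 0) ∧ s • x + t • y ∈ W := by
  by_contra! hcon
  set f : (ℝ × ℝ) × W →ₗ[ℝ] U :=
    ((LinearMap.toSpanSingleton ℝ U ⟨x, hx⟩).coprod (LinearMap.toSpanSingleton ℝ U ⟨y, hy⟩)).coprod
      (Submodule.inclusion hWU) with hf
  have hinj : Function.Injective f := by
    refine (injective_iff_map_eq_zero f).2 ?_
    rintro ⟨⟨s, t⟩, w⟩ h0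
    have h1 : s • x + t • y + (w : V) = 0 := by
      simpa [hf] using congrArg (Subtype.val : U → V) h0
    have h2 : s • x + t • y ∈ W := by
      rw [eq_neg_of_add_eq_zero_left h1]
      exact W.neg_mem w.2
    have h3 : s = 0 ∧ t = 0 := by
      by_contra h4
      exact hcon s t (not_and_or.1 h4) h2
    obtain ⟨rfl, rfl⟩ := h3
    simpa using h1
  have := LinearMap.finrank_le_finrank_of_injective hinj
  rw [finrank_prod, finrank_prod, finrank_self] at this
  omega

section MatrixGroups

open Matrix NormedSpace
open scoped Matrix.Norms.L2Operator

variable {n : Type*} [Fintype n]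

lemma hasDerivAt_matrix_iff {c : ℝ → Matrix n n ℂ} {w : Matrix n n ℂ} :
    HasDerivAt c w 0 ↔ ∀ i j, HasDerivAt (fun t => c t i j) (w i j) 0 := by
  refine Iff.trans (hasDerivAt_pi (φ := c) (φ' := w)) ?_
  exact forall_congr' fun i => hasDerivAt_pi

variable [DecidableEq n]

lemma exp_conj_diagonal {U : Matrix n n ℂ} (hU : U * Uᴴ = 1) (hU' : Uᴴ * U = 1) (d : n → ℝ) :
    exp (U * diagonal (fun i => Complex.I * d i) * Uᴴ) =
      U * diagonal (fun i => Complex.exp (Complex.I * d i)) * Uᴴ := by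
  rw [exp_mul_mul_eq hU hU', exp_diagonal]
  congr 3
  funext i
  rw [Pi.coe_exp, Complex.exp_eq_exp_ℂ]

lemma det_conj_diagonal {U : Matrix n n ℂ} (hU' : Uᴴ * U = 1) (v : n → ℂ) :
    (U * diagonal v * Uᴴ).det = ∏ i, v i := by
  rw [det_mul, det_mul, mul_right_comm, mul_comm U.det, ← det_mul, hU', det_one, one_mul,
    det_diagonal]

lemma det_exp_eq_one {X : Matrix n n ℂ} (hX : Xᴴ = -X) (htr : X.trace = 0) :
    (exp X).det = 1 := by
  obtain ⟨U, d, hU, hU', rfl⟩ := exists_unitary_diag hX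
  rw [trace_mul_comm, ← mul_assoc, hU', one_mul, trace_diagonal] at htr
  rw [exp_conj_diagonal hU hU', det_conj_diagonal hU', ← Complex.exp_sum, htr, Complex.exp_zero]

/-- Unitary matrices have skew-Hermitian logarithms. -/
lemma exists_exp_eq_of_unitary {A : Matrix n n ℂ} (h1 : A * Aᴴ = 1) (h2 : Aᴴ * A = 1) :
    ∃ S : Matrix n n ℂ, Sᴴ = -S ∧ exp S = A := by
  have hA : A ∈ unitary (Matrix n n ℂ) := Unitary.mem_iff.2 ⟨h2, h1⟩
  have hn : IsStarNormal A := ⟨h2.trans h1.symm⟩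
  have hfin : Finite (spectrum ℂ A) := (Matrix.finite_spectrum A).to_subtype
  set f : ℂ → ℂ := fun z => Complex.I * Complex.arg z with hf
  have hcont : ContinuousOn f (spectrum ℂ A) :=
    continuousOn_iff_continuous_domRestrict.2 continuous_of_discreteTopology
  refine ⟨cfc f A, ?_, ?_⟩
  · rw [← star_eq_conjTranspose, ← cfc_star, ← cfc_neg]
    congr 1
    funext z
    simp [hf]
  · have hS : IsStarNormal (cfc f A) := cfc_predicate f A
    rw [← CFC.complex_exp_eq_normedSpace_exp hS,
      ← cfc_comp Complex.exp f A hn Complex.continuous_exp.continuousOn hcont]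
    conv_rhs => rw [← cfc_id ℂ A hn]
    refine cfc_congr fun z hz => ?_
    have hz1 : ‖z‖ = 1 := by
      simpa using spectrum.subset_circle_of_unitary hA hz
    have := Complex.norm_mul_exp_arg_mul_I z
    rw [hz1] at this
    simpa [hf, mul_comm] using this

variable [Nonempty n]

lemma IsClosedUnitaryGroup.lie_le_matTangentAt {G : Set (Matrix n n ℂ)}
    (hG : IsClosedUnitaryGroup G) : hG.lie ≤ matTangentAt G 1 := fun X hX =>
  Submodule.subset_span ⟨fun t : ℝ => exp (t • X), hX, by simp,
    hasDerivAt_matrix_iff.1 (hasDerivAt_exp_smul_zero X)⟩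

lemma IsClosedUnitaryGroup.matTangentAt_lrOrbit_le {G H : Set (Matrix n n ℂ)}
    (hG : IsClosedUnitaryGroup G) (hH : IsClosedUnitaryGroup H) {k : Matrix n n ℂ}
    (hk : k * star k = 1) (hk' : star k * k = 1) :
    matTangentAt (lrOrbit G H k) k ≤
      ((hG.conj hk hk').lie ⊔ hH.lie).map (LinearMap.mulLeft ℝ k) := by
  refine Submodule.span_le.2 ?_
  rintro w ⟨c, hc, h0, hd⟩
  refine ⟨star k * w, ?_, by simp [← mul_assoc, hk]⟩
  refine (hG.conj hk hk').velocity_mem_sup_lie hH (c := fun t => star k * c t) (fun t => ?_)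
    (by simp [h0, hk']) ((hasDerivAt_matrix_iff.2 hd).const_mul (star k))
  obtain ⟨g, hg, h, hh, e⟩ := hc t
  refine ⟨star k * g * k, ?_, h, hh, by simp [e, mul_assoc]⟩
  change k * (star k * g * k) * star k ∈ G
  have : k * (star k * g * k) * star k = g := by
    calc k * (star k * g * k) * star k = (k * star k) * g * (k * star k) := by
          simp only [mul_assoc]
      _ = g := by rw [hk, one_mul, mul_one]
  rwa [this]

/-- If `G × H` acts with cohomogeneity at most one on `K`, then after conjugating `G` by some
`k ∈ K` the sum of the Lie algebras of `G` and `H` has codimension at most one in that of `K`. -/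
lemma IsClosedUnitaryGroup.exists_finrank_lie_le {G H K : Set (Matrix n n ℂ)}
    (hG : IsClosedUnitaryGroup G) (hH : IsClosedUnitaryGroup H) (hK : IsClosedUnitaryGroup K)
    (hcoh : lrCohomogeneity G H K ≤ 1) :
    ∃ k, ∃ hk : k ∈ K, finrank ℝ hK.lie ≤
      finrank ℝ ((hG.conj (hK.mul_star_self hk) (hK.star_mul_self hk)).lie ⊔ hH.lie :
        Submodule ℝ (Matrix n n ℂ)) + 1 := by
  have : Nonempty K := ⟨⟨1, hK.one_mem⟩⟩
  set d : K → ℕ := fun k => finrank ℝ (matTangentAt (lrOrbit G H k) (k : Matrix n n ℂ)) with hd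
  have hbdd : BddAbove (Set.range d) := by
    refine ⟨finrank ℝ (Matrix n n ℂ), ?_⟩
    rintro _ ⟨k, rfl⟩
    exact Submodule.finrank_le _
  obtain ⟨⟨k, hk⟩, hkd⟩ := Nat.sSup_mem (Set.range_nonempty d) hbdd
  refine ⟨k, hk, ?_⟩
  have h1 : finrank ℝ (matTangentAt K 1) ≤ d ⟨k, hk⟩ + 1 := by
    rw [hkd]
    exact tsub_le_iff_left.1 hcoh
  refine (Submodule.finrank_mono hK.lie_le_matTangentAt).trans (h1.trans ?_)
  gcongr
  exact (Submodule.finrank_mono (hG.matTangentAt_lrOrbit_le hH (hK.mul_star_self hk)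
    (hK.star_mul_self hk))).trans (Submodule.finrank_map_le _ _)

lemma exists_diagonal_sum_eq_zero {A : Matrix n n ℂ} (h1 : A * Aᴴ = 1) (h2 : Aᴴ * A = 1)
    (hdet : A.det = 1) : ∃ (U : Matrix n n ℂ) (d : n → ℝ), U * Uᴴ = 1 ∧ Uᴴ * U = 1 ∧
      ∑ i, d i = 0 ∧ A = U * diagonal (fun i => Complex.exp (Complex.I * d i)) * Uᴴ := by
  obtain ⟨S, hS, rfl⟩ := exists_exp_eq_of_unitary h1 h2
  obtain ⟨U, d, hU, hU', rfl⟩ := exists_unitary_diag hS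
  rw [exp_conj_diagonal hU hU', det_conj_diagonal hU', ← Complex.exp_sum,
    Complex.exp_eq_one_iff] at hdet
  obtain ⟨m, hm⟩ := hdet
  have hsum : ∑ i, d i = m * (2 * Real.pi) := by
    rw [← Finset.mul_sum] at hm
    have h3 : Complex.I * (∑ i, (d i : ℂ)) = Complex.I * (m * (2 * Real.pi)) := by
      rw [hm]; ring
    have h4 := mul_left_cancel₀ Complex.I_ne_zero h3
    exact_mod_cast h4
  obtain ⟨k⟩ := ‹Nonempty n›
  refine ⟨U, fun i => d i - if i = k then m * (2 * Real.pi) else 0, hU, hU', ?_, ?_⟩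
  · rw [Finset.sum_sub_distrib, hsum]
    simp
  · rw [exp_conj_diagonal hU hU']
    congr 3
    funext i
    by_cases hi : i = k
    · simp only [hi, if_true]
      refine Complex.exp_eq_exp_iff_exists_int.2 ⟨m, ?_⟩
      push_cast
      ring
    · simp [hi]

lemma mul_single_eq_single_mul_iff {m : Type*} [Fintype m] [DecidableEq m] {A : Matrix m m ℂ}
    {i j : m} : A * single i j 1 = single i j 1 * A ↔
      (∀ a, a ≠ i → A a i = 0) ∧ (∀ b, b ≠ j → A j b = 0) ∧ A i i = A j j := by
  have hl : ∀ a b, (A * (single i j 1 : Matrix m m ℂ)) a b =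
      if b = j then A a i else 0 := fun a b => by
    by_cases h : b = j
    · subst h; simp
    · simp [h, mul_single_apply_of_ne]
  have hr : ∀ a b, ((single i j 1 : Matrix m m ℂ) * A) a b =
      if a = i then A j b else 0 := fun a b => by
    by_cases h : a = i
    · subst h; simp
    · simp [h, single_mul_apply_of_ne]
  constructor
  · intro h
    have h' : ∀ a b, (if b = j then A a i else 0) = if a = i then A j b else 0 := fun a b => by
      rw [← hl, ← hr, h]
    exact ⟨fun a ha => by simpa [ha] using h' a j, fun b hb => by simpa [hb] using (h' i b).symm,
      by simpa using h' i j⟩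
  · rintro ⟨h1, h2, h3⟩
    ext a b
    rw [hl, hr]
    by_cases ha : a = i <;> by_cases hb : b = j
    · simp [ha, hb, h3]
    · simp [ha, hb, h2 b hb]
    · simp [ha, hb, h1 a ha]
    · simp [ha, hb]

variable {p q : ℕ}

lemma isClosedUnitaryGroup_SUPairSet (p q : ℕ) : IsClosedUnitaryGroup (SUPairSet p q) where
  one_mem := by simp [SUPairSet]
  mul_mem := by
    rintro a b ⟨ha1, ha2, ha3, ha4⟩ ⟨hb1, hb2, hb3, hb4⟩
    refine ⟨?_, ?_, fun i j => ?_, by rw [det_mul, ha4, hb4, one_mul]⟩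
    · rw [star_mul, mul_assoc, ← mul_assoc (star a), ha1, one_mul, hb1]
    · rw [star_mul, mul_assoc, ← mul_assoc b, hb2, one_mul, ha2]
    · simp [mul_apply, ha3, hb3]
  star_mem := by
    rintro a ⟨ha1, ha2, ha3, ha4⟩
    refine ⟨by rwa [star_star], by rwa [star_star], fun i j => ?_, ?_⟩
    · simp [star_apply, ha3]
    · rw [star_eq_conjTranspose, det_conjTranspose, ha4, star_one]
  mul_star_self := fun ha => ha.2.1
  star_mul_self := fun ha => ha.1
  isClosed := by
    have h : SUPairSet p q = {A | star A * A = 1} ∩ {A | A * star A = 1} ∩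
        (⋂ i : Fin p, ⋂ j : Fin q, {A | A (Sum.inl i) (Sum.inr j) = 0} ∩
          {A | A (Sum.inr j) (Sum.inl i) = 0}) ∩ {A | A.det = 1} := by
      ext A
      simp [SUPairSet, and_assoc]
    rw [h]
    refine ((isClosed_eq (by fun_prop) continuous_const).inter
      (isClosed_eq (by fun_prop) continuous_const)).inter (isClosed_iInter fun i =>
        isClosed_iInter fun j => ?_) |>.inter (isClosed_eq (by fun_prop) continuous_const)
    exact (isClosed_eq (by fun_prop) continuous_const).inter
      (isClosed_eq (by fun_prop) continuous_const)

lemma IsMatSubgroup.isClosedUnitaryGroup {G : Set (Matrix (Fin p ⊕ Fin q) (Fin p ⊕ Fin q) ℂ)}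
    (hgrp : IsMatSubgroup G) (hGK : G ⊆ SUPairSet p q) (hclosed : IsClosed G) :
    IsClosedUnitaryGroup G where
  one_mem := hgrp.1
  mul_mem := fun ha hb => hgrp.2.1 _ ha _ hb
  star_mem := fun ha => hgrp.2.2 _ ha
  mul_star_self := fun ha => (hGK ha).2.1
  star_mul_self := fun ha => (hGK ha).1
  isClosed := hclosed

/-- The principal isotropy group is a centralizer in `S(U p × U q)`. -/
lemma mem_SUPrincipalIsotropy_iff (hqp : q ≤ p) {A : Matrix (Fin p ⊕ Fin q) (Fin p ⊕ Fin q) ℂ} :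
    A ∈ SUPrincipalIsotropy p q hqp ↔ A ∈ SUPairSet p q ∧ ∀ i : Fin q,
      A * single (Sum.inl (i.castLE hqp)) (Sum.inr i) 1 =
        single (Sum.inl (i.castLE hqp)) (Sum.inr i) 1 * A ∧
      A * single (Sum.inr i) (Sum.inl (i.castLE hqp)) 1 =
        single (Sum.inr i) (Sum.inl (i.castLE hqp)) 1 * A := by
  simp only [mul_single_eq_single_mul_iff]
  constructor
  · rintro ⟨hA, h1, h2, h3, h4⟩
    refine ⟨hA, fun i => ⟨⟨?_, ?_, (h4 i).symm⟩, ?_, ?_, h4 i⟩⟩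
    · rintro (a | a) ha
      · by_cases haq : (a : ℕ) < q
        · exact h1 a haq _ (fun h => ha h.symm)
        · exact h2 a (not_lt.1 haq) _ i.isLt
      · exact (hA.2.2.1 _ _).2
    · rintro (b | b) hb
      · exact (hA.2.2.1 _ _).2
      · exact h3 _ _ (fun h => hb (h ▸ rfl))
    · rintro (a | a) ha
      · exact (hA.2.2.1 _ _).1
      · exact h3 _ _ (fun h => ha (h ▸ rfl))
    · intro b hb
      exact h1 _ i.isLt _ hb
  · rintro ⟨hA, h⟩
    refine ⟨hA, fun i hi j hj => ?_, fun i hi j hj => ?_, fun i j hij => ?_,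
      fun i => (h i).2.2.2⟩
    · exact (h ⟨i, hi⟩).2.2.1 j hj
    · refine (h ⟨j, hj⟩).1.1 (Sum.inl i) fun h => ?_
      have := congrArg Fin.val (Sum.inl_injective h)
      simp only [Fin.val_castLE] at this
      omega
    · exact (h i).1.2.1 _ fun h => hij (Sum.inr_injective h).symm

lemma isClosedUnitaryGroup_SUPrincipalIsotropy (hqp : q ≤ p) :
    IsClosedUnitaryGroup (SUPrincipalIsotropy p q hqp) where
  one_mem := (mem_SUPrincipalIsotropy_iff hqp).2
    ⟨(isClosedUnitaryGroup_SUPairSet p q).one_mem, by simp⟩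
  mul_mem := by
    intro a b ha hb
    rw [mem_SUPrincipalIsotropy_iff] at ha hb ⊢
    refine ⟨(isClosedUnitaryGroup_SUPairSet p q).mul_mem ha.1 hb.1, fun i => ⟨?_, ?_⟩⟩
    · rw [mul_assoc, (hb.2 i).1, ← mul_assoc, (ha.2 i).1, mul_assoc]
    · rw [mul_assoc, (hb.2 i).2, ← mul_assoc, (ha.2 i).2, mul_assoc]
  star_mem := by
    intro a ha
    rw [mem_SUPrincipalIsotropy_iff] at ha ⊢
    refine ⟨(isClosedUnitaryGroup_SUPairSet p q).star_mem ha.1, fun i => ⟨?_, ?_⟩⟩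
    · simpa [star_eq_conjTranspose] using (congrArg star (ha.2 i).2).symm
    · simpa [star_eq_conjTranspose] using (congrArg star (ha.2 i).1).symm
  mul_star_self := fun ha => ha.1.2.1
  star_mul_self := fun ha => ha.1.1
  isClosed := by
    have h : SUPrincipalIsotropy p q hqp = SUPairSet p q ∩ ⋂ i : Fin q,
        {A | A * single (Sum.inl (i.castLE hqp)) (Sum.inr i) 1 =
          single (Sum.inl (i.castLE hqp)) (Sum.inr i) 1 * A} ∩
        {A | A * single (Sum.inr i) (Sum.inl (i.castLE hqp)) 1 =
          single (Sum.inr i) (Sum.inl (i.castLE hqp)) 1 * A} := by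
      ext A
      simp [mem_SUPrincipalIsotropy_iff]
    rw [h]
    exact (isClosedUnitaryGroup_SUPairSet p q).isClosed.inter (isClosed_iInter fun i =>
      (isClosed_eq (by fun_prop) (by fun_prop)).inter (isClosed_eq (by fun_prop) (by fun_prop)))

lemma IsClosedUnitaryGroup.lie_apply_eq_zero {n : Type*} [Fintype n] [DecidableEq n] [Nonempty n]
    {G : Set (Matrix n n ℂ)} (hG : IsClosedUnitaryGroup G) {X : Matrix n n ℂ} (hX : X ∈ hG.lie)
    {i j : n} (h : ∀ a ∈ G, a i j = 0) : X i j = 0 := by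
  have h1 := hasDerivAt_matrix_iff.1 (hasDerivAt_exp_smul_zero X) i j
  have h2 : (fun t : ℝ => exp (t • X) i j) = fun _ => 0 := funext fun t => h _ (hX t)
  rw [h2] at h1
  exact h1.unique (hasDerivAt_const _ _)

lemma fromBlocks_mem_lie_SUPairSet [Nonempty (Fin p ⊕ Fin q)] {A : Matrix (Fin p) (Fin p) ℂ}
    {B : Matrix (Fin q) (Fin q) ℂ} (hA : Aᴴ = -A) (hB : Bᴴ = -B) (htA : A.trace = 0)
    (htB : B.trace = 0) : fromBlocks A 0 0 B ∈ (isClosedUnitaryGroup_SUPairSet p q).lie := by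
  intro t
  have hX : (t • fromBlocks A 0 0 B)ᴴ = -(t • fromBlocks A 0 0 B) := by
    rw [conjTranspose_smul, fromBlocks_conjTranspose, hA, hB, ← smul_neg, fromBlocks_neg]
    simp
  have htr : (t • fromBlocks A 0 0 B).trace = 0 := by
    have : (fromBlocks A 0 0 B).trace = A.trace + B.trace := by simp [trace]
    rw [trace_smul, this, htA, htB, add_zero, smul_zero]
  have hcomm : Commute (exp (t • fromBlocks A 0 0 B))
      (fromBlocks (1 : Matrix (Fin p) (Fin p) ℂ) 0 0 (0 : Matrix (Fin q) (Fin q) ℂ)) := by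
    refine Commute.exp_left (Commute.smul_left ?_ t)
    simp [commute_iff_eq, fromBlocks_multiply]
  have hu : exp (t • fromBlocks A 0 0 B) ∈ unitary _ := by
    let _ : NormedAlgebra ℚ (Matrix (Fin p ⊕ Fin q) (Fin p ⊕ Fin q) ℂ) :=
      NormedAlgebra.restrictScalars ℚ ℝ _
    exact exp_mem_unitary_of_mem_skewAdjoint (skewAdjoint.mem_iff.2 hX)
  obtain ⟨h1, h2⟩ := Unitary.mem_iff.1 hu
  refine ⟨h1, h2, fun i j => ⟨?_, ?_⟩, det_exp_eq_one hX htr⟩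
  · have := congrFun (congrFun hcomm.eq (Sum.inl i)) (Sum.inr j)
    simpa [mul_apply, one_apply] using this.symm
  · have := congrFun (congrFun hcomm.eq (Sum.inr j)) (Sum.inl i)
    simpa [mul_apply, one_apply] using this

theorem IsClosedUnitaryGroup.fromBlocks_mem_lie (hq : 5 ≤ q) (hqp : q ≤ p)
    [Nonempty (Fin p ⊕ Fin q)] {G : Set (Matrix (Fin p ⊕ Fin q) (Fin p ⊕ Fin q) ℂ)}
    (hG : IsClosedUnitaryGroup G) (hGK : G ⊆ SUPairSet p q)
    (hfin : finrank ℝ (isClosedUnitaryGroup_SUPairSet p q).lie ≤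
      finrank ℝ (hG.lie ⊔ (isClosedUnitaryGroup_SUPrincipalIsotropy hqp).lie :
        Submodule ℝ (Matrix (Fin p ⊕ Fin q) (Fin p ⊕ Fin q) ℂ)) + 1)
    {A : Matrix (Fin p) (Fin p) ℂ} {B : Matrix (Fin q) (Fin q) ℂ} (hA : Aᴴ = -A) (hB : Bᴴ = -B)
    (htA : A.trace = 0) (htB : B.trace = 0) : fromBlocks A 0 0 B ∈ hG.lie := by
  refine fromBlocks_mem_of_codim_le_one hq hqp ⟨fun X hX => hG.star_of_mem_lie hX,
    fun X hX Y hY => hG.bracket_mem_lie hX hY⟩ (fun X hX => ?_) ?_ hA hB htA htB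
  · ext i j
    rcases i with i | i <;> rcases j with j | j
    · rfl
    · exact hG.lie_apply_eq_zero hX fun a ha => ((hGK ha).2.2.1 i j).1
    · exact hG.lie_apply_eq_zero hX fun a ha => ((hGK ha).2.2.1 j i).2
    · rfl
  · intro X₁ Y₁ X₂ Y₂ hX₁ hY₁ hX₂ hY₂ hX₁0 hY₁0 hX₂0 hY₂0
    have htr : ∀ {m : ℕ} {M : Matrix (Fin m) (Fin m) ℂ}, (∀ i, M i i = 0) → M.trace = 0 :=
      fun h => Finset.sum_eq_zero fun i _ => h i
    have hle : hG.lie ⊔ (isClosedUnitaryGroup_SUPrincipalIsotropy hqp).lie ≤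
        (isClosedUnitaryGroup_SUPairSet p q).lie :=
      sup_le (hG.lie_mono _ hGK) (IsClosedUnitaryGroup.lie_mono _ _ fun _ h => h.1)
    obtain ⟨s, t, hst, hmem⟩ := exists_combination_mem_of_finrank_le hle hfin
      (fromBlocks_mem_lie_SUPairSet hX₁ hX₂ (htr hX₁0) (htr hX₂0))
      (fromBlocks_mem_lie_SUPairSet hY₁ hY₂ (htr hY₁0) (htr hY₂0))
    obtain ⟨Z, hZ, W, hW, hZW⟩ := Submodule.mem_sup.1 hmem
    refine ⟨s, t, hst, Z, hZ, fun i j hij hlt => ?_, fun i j hij => ?_⟩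
    · have hW0 : W (Sum.inl i) (Sum.inl j) = 0 := by
        refine IsClosedUnitaryGroup.lie_apply_eq_zero _ hW fun a ha => ?_
        by_cases hi : (i : ℕ) < q
        · exact ha.2.1 i hi _ fun h => hij (Sum.inl_injective h).symm
        · exact ha.2.2.1 i (not_lt.1 hi) j (hlt.resolve_left hi)
      have := congrFun (congrFun hZW (Sum.inl i)) (Sum.inl j)
      rw [Matrix.add_apply, hW0, add_zero] at this
      exact this
    · have hW0 : W (Sum.inr i) (Sum.inr j) = 0 :=
        IsClosedUnitaryGroup.lie_apply_eq_zero _ hW fun a ha => ha.2.2.2.1 i j hij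
      have := congrFun (congrFun hZW (Sum.inr i)) (Sum.inr j)
      rw [Matrix.add_apply, hW0, add_zero] at this
      exact this

lemma eq_fromBlocks_of_mem_SUPairSet
    {a : Matrix (Fin p ⊕ Fin q) (Fin p ⊕ Fin q) ℂ} (ha : a ∈ SUPairSet p q) :
    a = fromBlocks a.toBlocks₁₁ 0 0 a.toBlocks₂₂ := by
  ext i j
  rcases i with i | i <;> rcases j with j | j
  · rfl
  · exact (ha.2.2.1 i j).1
  · exact (ha.2.2.1 j i).2
  · rfl

theorem SUProdSet_subset_of_fromBlocks_mem_lie [Nonempty (Fin p)] [Nonempty (Fin q)]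
    {G : Set (Matrix (Fin p ⊕ Fin q) (Fin p ⊕ Fin q) ℂ)} (hG : IsClosedUnitaryGroup G)
    (h : ∀ (A : Matrix (Fin p) (Fin p) ℂ) (B : Matrix (Fin q) (Fin q) ℂ), Aᴴ = -A → Bᴴ = -B →
      A.trace = 0 → B.trace = 0 → fromBlocks A 0 0 B ∈ hG.lie) : SUProdSet p q ⊆ G := by
  rintro a ⟨haK, hd1, hd2⟩
  have ha := eq_fromBlocks_of_mem_SUPairSet haK
  obtain ⟨ha1, ha2, -⟩ := haK
  set A := a.toBlocks₁₁
  set B := a.toBlocks₂₂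
  rw [star_eq_conjTranspose, ha, fromBlocks_conjTranspose, fromBlocks_multiply, ← fromBlocks_one,
    fromBlocks_inj] at ha1 ha2
  simp only [conjTranspose_zero, Matrix.mul_zero, add_zero, zero_add] at ha1 ha2
  obtain ⟨U, d, hU, hU', hd, hA⟩ := exists_diagonal_sum_eq_zero ha2.1 ha1.1 hd1
  obtain ⟨V, e, hV, hV', he, hB⟩ := exists_diagonal_sum_eq_zero ha2.2.2.2 ha1.2.2.2 hd2
  have key : ∀ (v : Fin p → ℂ) (w : Fin q → ℂ),
      fromBlocks U 0 0 V * diagonal (Sum.elim v w) * (fromBlocks U 0 0 V)ᴴ =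
        fromBlocks (U * diagonal v * Uᴴ) 0 0 (V * diagonal w * Vᴴ) := fun v w => by
    rw [← fromBlocks_diagonal, fromBlocks_conjTranspose, fromBlocks_multiply, fromBlocks_multiply]
    simp
  have hW : fromBlocks U 0 0 V * (fromBlocks U 0 0 V)ᴴ = 1 := by
    rw [fromBlocks_conjTranspose, fromBlocks_multiply]
    simp [hU, hV]
  have hW' : (fromBlocks U 0 0 V)ᴴ * fromBlocks U 0 0 V = 1 := by
    rw [fromBlocks_conjTranspose, fromBlocks_multiply]
    simp [hU', hV']
  have skew : ∀ {m : ℕ} (M : Matrix (Fin m) (Fin m) ℂ) (f : Fin m → ℝ),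
      (M * diagonal (fun i => Complex.I * f i) * Mᴴ)ᴴ =
        -(M * diagonal (fun i => Complex.I * f i) * Mᴴ) := fun M f => by
    rw [conjTranspose_mul, conjTranspose_mul, conjTranspose_conjTranspose, diagonal_conjTranspose,
      ← mul_assoc, ← Matrix.neg_mul, ← Matrix.mul_neg, diagonal_neg]
    congr 3
    funext i
    simp
  have trace_zero : ∀ {m : ℕ} {M : Matrix (Fin m) (Fin m) ℂ} (f : Fin m → ℝ), Mᴴ * M = 1 →
      ∑ i, f i = 0 → (M * diagonal (fun i => Complex.I * f i) * Mᴴ).trace = 0 := fun f hM hf => by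
    rw [trace_mul_comm, ← mul_assoc, hM, one_mul, trace_diagonal, ← Finset.mul_sum]
    have : ∑ i, (f i : ℂ) = 0 := by exact_mod_cast hf
    rw [this, mul_zero]
  have hmem := h _ _ (skew U d) (skew V e) (trace_zero d hU' hd) (trace_zero e hV' he) 1
  have h1 := key (fun i => Complex.I * d i) (fun i => Complex.I * e i)
  have h2 := key (fun i => Complex.exp (Complex.I * d i)) (fun i => Complex.exp (Complex.I * e i))
  have h3 := exp_conj_diagonal hW hW' (Sum.elim d e)
  have h4 : (fun i => Complex.I * ((Sum.elim d e i : ℝ) : ℂ)) =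
      Sum.elim (fun i => Complex.I * (d i : ℂ)) (fun i => Complex.I * (e i : ℂ)) := by
    funext i; cases i <;> rfl
  have h5 : (fun i => Complex.exp (Complex.I * ((Sum.elim d e i : ℝ) : ℂ))) =
      Sum.elim (fun i => Complex.exp (Complex.I * (d i : ℂ)))
        (fun i => Complex.exp (Complex.I * (e i : ℂ))) := by
    funext i; cases i <;> rfl
  rw [h4, h5, h1, h2, ← hA, ← hB, ← ha] at h3
  rwa [one_smul, h3] at hmem

section BlockDeterminant

variable {a b : Matrix (Fin p ⊕ Fin q) (Fin p ⊕ Fin q) ℂ}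

lemma det_toBlocks₁₁_mul (ha : a ∈ SUPairSet p q) (hb : b ∈ SUPairSet p q) :
    (a * b).toBlocks₁₁.det = a.toBlocks₁₁.det * b.toBlocks₁₁.det := by
  rw [eq_fromBlocks_of_mem_SUPairSet ha, eq_fromBlocks_of_mem_SUPairSet hb, fromBlocks_multiply]
  simp

lemma det_toBlocks₁₁_mul_det_toBlocks₂₂ (ha : a ∈ SUPairSet p q) :
    a.toBlocks₁₁.det * a.toBlocks₂₂.det = 1 := by
  rw [← det_fromBlocks_zero₂₁ a.toBlocks₁₁ 0, ← eq_fromBlocks_of_mem_SUPairSet ha]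
  exact ha.2.2.2

lemma mem_SUProdSet_iff : a ∈ SUProdSet p q ↔ a ∈ SUPairSet p q ∧ a.toBlocks₁₁.det = 1 := by
  refine ⟨fun h => ⟨h.1, h.2.1⟩, fun h => ⟨h.1, h.2, ?_⟩⟩
  simpa [h.2] using det_toBlocks₁₁_mul_det_toBlocks₂₂ h.1

lemma det_toBlocks₁₁_star (a : Matrix (Fin p ⊕ Fin q) (Fin p ⊕ Fin q) ℂ) :
    (star a).toBlocks₁₁.det = star a.toBlocks₁₁.det :=
  det_conjTranspose _

lemma star_det_toBlocks₁₁_mul (ha : a ∈ SUPairSet p q) :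
    star a.toBlocks₁₁.det * a.toBlocks₁₁.det = 1 := by
  have hK := isClosedUnitaryGroup_SUPairSet p q
  rw [← det_toBlocks₁₁_star, ← det_toBlocks₁₁_mul (hK.star_mem ha) ha, hK.star_mul_self ha,
    ← fromBlocks_one, toBlocks_fromBlocks₁₁, det_one]

lemma norm_det_toBlocks₁₁ (ha : a ∈ SUPairSet p q) : ‖a.toBlocks₁₁.det‖ = 1 := by
  have h := congrArg norm (star_det_toBlocks₁₁_mul ha)
  rw [norm_mul, norm_star, norm_one] at h
  nlinarith [norm_nonneg a.toBlocks₁₁.det]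

lemma det_toBlocks₁₁_pow (ha : a ∈ SUPairSet p q) (m : ℕ) :
    (a ^ m).toBlocks₁₁.det = a.toBlocks₁₁.det ^ m := by
  have hK := isClosedUnitaryGroup_SUPairSet p q
  induction m with
  | zero => rw [pow_zero, pow_zero, ← fromBlocks_one, toBlocks_fromBlocks₁₁, det_one]
  | succ m ih => rw [pow_succ, det_toBlocks₁₁_mul (hK.pow_mem ha m) ha, ih, pow_succ]

lemma star_mul_mul_mem_SUProdSet (ha : a ∈ SUPairSet p q) (hb : b ∈ SUProdSet p q) :
    star a * b * a ∈ SUProdSet p q := by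
  have hK := isClosedUnitaryGroup_SUPairSet p q
  rw [mem_SUProdSet_iff] at hb ⊢
  have h := hK.mul_mem (hK.star_mem ha) hb.1
  refine ⟨hK.mul_mem h ha, ?_⟩
  rw [det_toBlocks₁₁_mul h ha, det_toBlocks₁₁_mul (hK.star_mem ha) hb.1, hb.2, mul_one,
    det_toBlocks₁₁_star, star_det_toBlocks₁₁_mul ha]

/-- On a connected subgroup the determinant of the first block is trivial or takes every value
on the unit circle. -/
lemma IsClosedUnitaryGroup.exists_det_toBlocks₁₁_eq
    {G : Set (Matrix (Fin p ⊕ Fin q) (Fin p ⊕ Fin q) ℂ)} (hG : IsClosedUnitaryGroup G)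
    (hGK : G ⊆ SUPairSet p q) (hconn : IsPreconnected G) (ha : a ∈ G)
    (hne : a.toBlocks₁₁.det ≠ 1) {z : ℂ} (hz : ‖z‖ = 1) :
    ∃ g ∈ G, g.toBlocks₁₁.det = z := by
  have hcont : Continuous fun g : Matrix (Fin p ⊕ Fin q) (Fin p ⊕ Fin q) ℂ =>
      g.toBlocks₁₁.det.re :=
    Complex.continuous_re.comp
      (Continuous.matrix_det (continuous_id.matrix_submatrix Sum.inl Sum.inl))
  have hone : ((1 : Matrix (Fin p ⊕ Fin q) (Fin p ⊕ Fin q) ℂ).toBlocks₁₁).det.re = 1 := by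
    rw [← fromBlocks_one, toBlocks_fromBlocks₁₁, det_one, Complex.one_re]
  have hlt : a.toBlocks₁₁.det.re < 1 := by
    refine lt_of_le_of_ne ((Complex.re_le_norm _).trans_eq (norm_det_toBlocks₁₁ (hGK ha)))
      fun h => hne (Complex.ext h ?_)
    have := Complex.sq_norm a.toBlocks₁₁.det
    rw [norm_det_toBlocks₁₁ (hGK ha), Complex.normSq_apply, h] at this
    simpa using (by linarith : a.toBlocks₁₁.det.im * a.toBlocks₁₁.det.im = 0)
  obtain ⟨θ, rfl⟩ : ∃ θ : ℝ, Complex.exp (θ * Complex.I) = z := (Complex.norm_eq_one_iff z).1 hz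
  have htend : Filter.Tendsto (fun m : ℕ => Real.cos (θ / m)) Filter.atTop (nhds 1) := by
    simpa [Function.comp_def] using
      (Real.continuous_cos.tendsto 0).comp (tendsto_const_div_atTop_nhds_zero_nat θ)
  obtain ⟨m, hm, hm0⟩ := ((htend.eventually (lt_mem_nhds hlt)).and
    (Filter.eventually_gt_atTop 0)).exists
  obtain ⟨g, hg, hgm⟩ := hconn.intermediate_value ha hG.one_mem hcont.continuousOn
    ⟨hm.le, (Real.cos_le_one _).trans_eq hone.symm⟩
  have hpow : Complex.exp ((θ / m : ℝ) * Complex.I) ^ m = Complex.exp (θ * Complex.I) := by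
    rw [← Complex.exp_nat_mul]
    congr 1
    have : (m : ℂ) ≠ 0 := by exact_mod_cast hm0.ne'
    push_cast
    field_simp
  have hsq := Complex.sq_norm g.toBlocks₁₁.det
  rw [norm_det_toBlocks₁₁ (hGK hg), Complex.normSq_apply] at hsq
  replace hgm : g.toBlocks₁₁.det.re = Real.cos (θ / m) := hgm
  have him : g.toBlocks₁₁.det.im = Real.sin (θ / m) ∨ g.toBlocks₁₁.det.im = -Real.sin (θ / m) := by
    refine sq_eq_sq_iff_eq_or_eq_neg.1 ?_
    rw [hgm] at hsq
    nlinarith [Real.sin_sq_add_cos_sq (θ / m)]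
  rcases him with him | him
  · refine ⟨g ^ m, hG.pow_mem hg m, ?_⟩
    rw [det_toBlocks₁₁_pow (hGK hg), ← hpow]
    congr 1
    refine Complex.ext ?_ ?_
    · rw [hgm, Complex.exp_ofReal_mul_I_re]
    · rw [him, Complex.exp_ofReal_mul_I_im]
  · refine ⟨star g ^ m, hG.pow_mem (hG.star_mem hg) m, ?_⟩
    rw [det_toBlocks₁₁_pow (hGK (hG.star_mem hg)), det_toBlocks₁₁_star, ← hpow]
    congr 1
    refine Complex.ext ?_ ?_
    · rw [Complex.exp_ofReal_mul_I_re, ← hgm]; rfl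
    · rw [Complex.exp_ofReal_mul_I_im]
      change -g.toBlocks₁₁.det.im = _
      rw [him, neg_neg]

end BlockDeterminant

theorem SUProdSet_subset_of_lrCohomogeneity_le_one (hq : 5 ≤ q) (hqp : q ≤ p)
    {G : Set (Matrix (Fin p ⊕ Fin q) (Fin p ⊕ Fin q) ℂ)} (hG : IsClosedUnitaryGroup G)
    (hGK : G ⊆ SUPairSet p q)
    (hcoh : lrCohomogeneity G (SUPrincipalIsotropy p q hqp) (SUPairSet p q) ≤ 1) :
    SUProdSet p q ⊆ G := by
  have : Nonempty (Fin p) := ⟨⟨0, by omega⟩⟩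
  have : Nonempty (Fin q) := ⟨⟨0, by omega⟩⟩
  have hK := isClosedUnitaryGroup_SUPairSet p q
  obtain ⟨k, hk, hfin⟩ := hG.exists_finrank_lie_le
    (isClosedUnitaryGroup_SUPrincipalIsotropy hqp) hK hcoh
  have hk1 := hK.mul_star_self hk
  have hk2 := hK.star_mul_self hk
  have hsub : {a | k * a * star k ∈ G} ⊆ SUPairSet p q := fun a ha => by
    have h := hK.mul_mem (hK.mul_mem (hK.star_mem hk) (hGK ha)) hk
    have e : star k * (k * a * star k) * k = a := by
      rw [mul_assoc k a, ← mul_assoc (star k) k, hk2, one_mul, mul_assoc, hk2, mul_one]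
    rwa [e] at h
  have hprod := SUProdSet_subset_of_fromBlocks_mem_lie (hG.conj hk1 hk2)
    fun A B hA hB htA htB => (hG.conj hk1 hk2).fromBlocks_mem_lie hq hqp hsub hfin hA hB htA htB
  intro b hb
  have h : k * (star k * b * k) * star k ∈ G := hprod (star_mul_mul_mem_SUProdSet hk hb)
  have e : k * (star k * b * k) * star k = b := by
    rw [mul_assoc (star k) b, ← mul_assoc k (star k), hk1, one_mul, mul_assoc, hk1, mul_one]
  rwa [e] at h

theorem eq_SUProdSet_of_lrCohomogeneity_le_one (hq : 5 ≤ q) (hqp : q ≤ p)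
    {G : Set (Matrix (Fin p ⊕ Fin q) (Fin p ⊕ Fin q) ℂ)} (hG : IsClosedUnitaryGroup G)
    (hGK : G ⊆ SUPairSet p q) (hproper : G ≠ SUPairSet p q) (hconn : IsConnected G)
    (hcoh : lrCohomogeneity G (SUPrincipalIsotropy p q hqp) (SUPairSet p q) ≤ 1) :
    G = SUProdSet p q := by
  have hsub := SUProdSet_subset_of_lrCohomogeneity_le_one hq hqp hG hGK hcoh
  have hK := isClosedUnitaryGroup_SUPairSet p q
  refine Set.Subset.antisymm (fun a ha => mem_SUProdSet_iff.2 ⟨hGK ha, ?_⟩) hsub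
  by_contra hne
  refine hproper (Set.Subset.antisymm hGK fun b hb => ?_)
  obtain ⟨g, hg, hgb⟩ := hG.exists_det_toBlocks₁₁_eq hGK hconn.isPreconnected ha hne
    (norm_det_toBlocks₁₁ hb)
  have hmem : star g * b ∈ SUProdSet p q := mem_SUProdSet_iff.2
    ⟨hK.mul_mem (hK.star_mem (hGK hg)) hb, by
      rw [det_toBlocks₁₁_mul (hK.star_mem (hGK hg)) hb, ← hgb, det_toBlocks₁₁_star,
        star_det_toBlocks₁₁_mul (hGK hg)]⟩
  have h := hG.mul_mem hg (hsub hmem)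
  rwa [← mul_assoc, hG.mul_star_self hg, one_mul] at h

end MatrixGroups

end

theorem statement14 (p q : ℕ) (hq : 5 ≤ q) (hqp : q ≤ p)
    (G : Set (Matrix (Fin p ⊕ Fin q) (Fin p ⊕ Fin q) ℂ))
    (hGK : G ⊆ SUPairSet p q) (hproper : G ≠ SUPairSet p q)
    (hgrp : IsMatSubgroup G) (hclosed : IsClosed G) (hconn : IsConnected G)
    (hcoh : lrCohomogeneity G (SUPrincipalIsotropy p q hqp) (SUPairSet p q) ≤ 1) :
    G = SUProdSet p q :=
  eq_SUProdSet_of_lrCohomogeneity_le_one hq hqp (hgrp.isClosedUnitaryGroup hGK hclosed) hGK hproper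
    hconn hcoh
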